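/- arXiv:2601.08826 — 13 statements merged into one kernel-verified Lean document; each statement's English description precedes it below -/
import Mathlib

section
/- Let ∙ be an orthogonal Clifford module structure on v over z and fix S ∈ v. Then: (a) the orthogonal complement in v of the kernel of the linear map v → z, S̃ ↦ S ∗ S̃, equals the subspace z ∙ S := {Z ∙ S : Z ∈ z}; in particular, v is the orthogonal direct sum of ker(S ∗ ·) and z ∙ S. (b) ‖Z ∙ S‖² = ‖Z‖² · ‖S‖² for all Z ∈ z; hence for S ≠ 0 the map Z ↦ Z ∙ S is injective, and after rescaling the inner product on z by the factor ‖S‖² it is an isometry onto z ∙ S. -/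
open scoped RealInnerProductSpace

/-- For an orthogonal Clifford module structure `c` on `v` over `z` and a fixed
spinor `S`: (a) the orthogonal complement of `ker (S ∗ ·)` is `z ∙ S`, so `v` is the orthogonal
direct sum of these two subspaces; (b) `‖Z ∙ S‖² = ‖Z‖² ‖S‖²`, hence for `S ≠ 0` the map
`Z ↦ Z ∙ S` is injective (and, after rescaling the metric on `z` by `‖S‖²`, an isometry
onto `z ∙ S`). -/
theorem stmt_1 {z v : Type*}
    [NormedAddCommGroup z] [InnerProductSpace ℝ z] [FiniteDimensional ℝ z]
    [NormedAddCommGroup v] [InnerProductSpace ℝ v] [FiniteDimensional ℝ v]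
    [Nontrivial v]
    (c : z →ₗ[ℝ] v →ₗ[ℝ] v)
    (hc1 : ∀ (Z : z) (S S' : v), ⟪c Z S, S'⟫ = -⟪S, c Z S'⟫)
    (hc2 : ∀ (Z : z) (S : v), c Z (c Z S) = (-‖Z‖ ^ 2 : ℝ) • S)
    (sp : v →ₗ[ℝ] v →ₗ[ℝ] z)
    (hsp : ∀ (Z : z) (S S' : v), ⟪Z, sp S S'⟫ = ⟪c Z S, S'⟫)
    (S : v) :
    ((LinearMap.ker (sp S))ᗮ = LinearMap.range (c.flip S)) ∧
    IsCompl (LinearMap.ker (sp S)) (LinearMap.range (c.flip S)) ∧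
    (∀ Z : z, ‖c Z S‖ ^ 2 = ‖Z‖ ^ 2 * ‖S‖ ^ 2) ∧
    (S ≠ 0 → Function.Injective (c.flip S)) := by
  have hker : LinearMap.ker (sp S) = (LinearMap.range (c.flip S))ᗮ := by
    ext T
    rw [LinearMap.mem_ker, Submodule.mem_orthogonal]
    constructor
    · rintro hT _ ⟨Z, rfl⟩
      rw [LinearMap.flip_apply, ← hsp, hT, inner_zero_right]
    · intro hT
      refine ext_inner_left ℝ fun Z => ?_
      rw [hsp, inner_zero_right]
      exact hT _ ⟨Z, rfl⟩
  have hnorm : ∀ Z : z, ‖c Z S‖ ^ 2 = ‖Z‖ ^ 2 * ‖S‖ ^ 2 := fun Z => by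
    rw [← real_inner_self_eq_norm_sq, hc1, hc2, real_inner_smul_right,
      real_inner_self_eq_norm_sq]
    ring
  refine ⟨?_, ?_, hnorm, fun hS => ?_⟩
  · rw [hker, Submodule.orthogonal_orthogonal]
  · rw [hker]
    exact (Submodule.isCompl_orthogonal _).symm
  · refine (injective_iff_map_eq_zero _).2 fun Z hZ => ?_
    have h := hnorm Z
    rw [← LinearMap.flip_apply, hZ] at h
    simpa [hS] using h.symm
end

section
/- Let ∙ be an orthogonal Clifford module structure on v over z and let X = (X_z, X_v) ∈ z × v. Then the operator K̂(X) satisfies: (i) K̂(X) Z = X_v ∗ (Z ∙ (X_z ∙ X_v)) and also K̂(X) Z = (Z ∙ X_v) ∗ (X_z ∙ X_v) for every Z ∈ z; (ii) K̂(X) is skew-symmetric, i.e. ⟪K̂(X) Z₁, Z₂⟫ = −⟪Z₁, K̂(X) Z₂⟫ for all Z₁, Z₂ ∈ z; (iii) K̂(X) X_z = 0 and ⟪K̂(X) Z, X_z⟫ = 0 for all Z ∈ z. -/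
open scoped RealInnerProductSpace

section CliffordModule

variable {z v : Type*}
  [NormedAddCommGroup z] [InnerProductSpace ℝ z]
  [NormedAddCommGroup v] [InnerProductSpace ℝ v]
  {c : z →ₗ[ℝ] v →ₗ[ℝ] v}

/-- The polarized Clifford relation. -/
theorem clifford_anticommutator
    (hc2 : ∀ (Z : z) (S : v), c Z (c Z S) = (-‖Z‖ ^ 2 : ℝ) • S) (Z₁ Z₂ : z) (S : v) :
    c Z₁ (c Z₂ S) + c Z₂ (c Z₁ S) = (-2 * ⟪Z₁, Z₂⟫) • S := by
  have h := hc2 (Z₁ + Z₂) S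
  have h₁ := hc2 Z₁ S
  have h₂ := hc2 Z₂ S
  simp only [map_add, LinearMap.add_apply, norm_add_sq_real, h₁, h₂] at h
  linear_combination (norm := module) h

/-- Skew-adjoint Clifford multiplication sends a spinor to its orthogonal complement. -/
theorem clifford_inner_self_eq_zero
    (hc1 : ∀ (Z : z) (S S' : v), ⟪c Z S, S'⟫ = -⟪S, c Z S'⟫) (Z : z) (S : v) :
    ⟪c Z S, S⟫ = 0 := by
  have h := hc1 Z S S
  rw [real_inner_comm (c Z S) S] at h
  linarith

/-- The trilinear expression defining `K̂` is skew in its two free arguments. -/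
theorem clifford_inner_skew
    (hc1 : ∀ (Z : z) (S S' : v), ⟪c Z S, S'⟫ = -⟪S, c Z S'⟫)
    (hc2 : ∀ (Z : z) (S : v), c Z (c Z S) = (-‖Z‖ ^ 2 : ℝ) • S) (W Z₁ Z₂ : z) (S : v) :
    ⟪c Z₁ (c W S), c Z₂ S⟫ = -⟪c Z₂ (c W S), c Z₁ S⟫ := by
  have h := congrArg (fun T => ⟪c W S, T⟫) (clifford_anticommutator hc2 Z₁ Z₂ S)
  simp only [inner_add_right, inner_smul_right, clifford_inner_self_eq_zero hc1, mul_zero] at h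
  rw [hc1 Z₁, hc1 Z₂]
  linarith

end CliffordModule

/-- Properties of the operator `K̂(X)`: explicit descriptions via the spinor
product, skew-symmetry, and vanishing on (and orthogonality to) `X_z`. -/
theorem stmt_2 {z v : Type*}
    [NormedAddCommGroup z] [InnerProductSpace ℝ z] [FiniteDimensional ℝ z]
    [NormedAddCommGroup v] [InnerProductSpace ℝ v] [FiniteDimensional ℝ v]
    [Nontrivial v]
    (c : z →ₗ[ℝ] v →ₗ[ℝ] v)
    (hc1 : ∀ (Z : z) (S S' : v), ⟪c Z S, S'⟫ = -⟪S, c Z S'⟫)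
    (hc2 : ∀ (Z : z) (S : v), c Z (c Z S) = (-‖Z‖ ^ 2 : ℝ) • S)
    (sp : v →ₗ[ℝ] v →ₗ[ℝ] z)
    (hsp : ∀ (Z : z) (S S' : v), ⟪Z, sp S S'⟫ = ⟪c Z S, S'⟫)
    (K : z × v → z →ₗ[ℝ] z)
    (hK : ∀ (X : z × v) (Z₁ Z₂ : z), ⟪K X Z₁, Z₂⟫ = ⟪c Z₁ (c X.1 X.2), c Z₂ X.2⟫)
    (X : z × v) :
    ((∀ Z : z, K X Z = sp X.2 (c Z (c X.1 X.2))) ∧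
     (∀ Z : z, K X Z = sp (c Z X.2) (c X.1 X.2))) ∧
    (∀ Z₁ Z₂ : z, ⟪K X Z₁, Z₂⟫ = -⟪Z₁, K X Z₂⟫) ∧
    (K X X.1 = 0 ∧ ∀ Z : z, ⟪K X Z, X.1⟫ = 0) := by
  have skew : ∀ Z₁ Z₂ : z, ⟪K X Z₁, Z₂⟫ = -⟪Z₁, K X Z₂⟫ := fun Z₁ Z₂ => by
    rw [← real_inner_comm Z₁ (K X Z₂), hK, hK, clifford_inner_skew hc1 hc2]
  have kill : ∀ Z : z, ⟪K X X.1, Z⟫ = 0 := fun Z => by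
    rw [hK, hc2, inner_smul_left, real_inner_comm, clifford_inner_self_eq_zero hc1, mul_zero]
  refine ⟨⟨fun Z => ext_inner_left ℝ fun Z₂ => ?_, fun Z => ext_inner_left ℝ fun Z₂ => ?_⟩, skew,
    inner_self_eq_zero.mp (kill _), fun Z => ?_⟩
  · rw [hsp, real_inner_comm, hK, real_inner_comm]
  · rw [hsp, real_inner_comm, hK, clifford_inner_skew hc1 hc2, hc1 Z₂, hc1 Z₂, neg_neg,
      real_inner_comm, hc1, real_inner_comm]
  · rw [skew, real_inner_comm, kill, neg_zero]
end

section
/- Let ∙' and ∙'' be orthogonal Clifford module structures on v' and v'' over z, and equip v' × v'' with the product inner product and the direct-sum Clifford module structure Z ∙ (S', S'') := (Z ∙' S', Z ∙'' S''). Let Z₀ ∈ z, S' ∈ v', S'' ∈ v'' with Z₀ ≠ 0, S' ≠ 0, S'' ≠ 0, and set X := (Z₀, (S', S'')), X' := (Z₀, S'), X'' := (Z₀, S''). Then for Z ∈ z, the equation K̂(X)² Z = −‖Z₀‖² · (‖S'‖² + ‖S''‖²)² · Z holds if and only if all three of the following hold: K̂'(X')² Z = −‖Z₀‖² · ‖S'‖⁴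 · Z, K̂''(X'')² Z = −‖Z₀‖² · ‖S''‖⁴ · Z, and ‖S''‖² · K̂'(X') Z = ‖S'‖² · K̂''(X'') Z. -/
open scoped RealInnerProductSpace

section SkewPair

variable {E : Type*} [NormedAddCommGroup E] [InnerProductSpace ℝ E]

theorem skew_of_inner_self_eq_zero {A : E →ₗ[ℝ] E} (h : ∀ x, ⟪A x, x⟫ = 0) (x y : E) :
    ⟪A x, y⟫ = -⟪x, A y⟫ := by
  have hxy := h (x + y)
  rw [map_add, inner_add_left, inner_add_right, inner_add_right, h x, h y] at hxy
  rw [real_inner_comm (A y) x]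
  linarith

/-- A skew operator with norm at most `a` that attains its norm at `x` squares to `-a ^ 2` at
`x`. -/
theorem skew_apply_apply_eq_of_norm_eq {A : E →ₗ[ℝ] E} {a : ℝ}
    (hA : ∀ x, ⟪A x, x⟫ = 0) (hAn : ∀ x, ‖A x‖ ≤ a * ‖x‖) {x : E} (hx : ‖A x‖ = a * ‖x‖) :
    A (A x) = (-a ^ 2) • x := by
  have hi : ⟪A (A x), x⟫ = -(a * ‖x‖) ^ 2 := by
    rw [skew_of_inner_self_eq_zero hA, real_inner_self_eq_norm_sq, hx]
  have hn : ‖A (A x)‖ ^ 2 ≤ (a * (a * ‖x‖)) ^ 2 := by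
    have := hAn (A x)
    rw [hx] at this
    gcongr
  have hs : ‖A (A x) - (-a ^ 2) • x‖ ^ 2 ≤ 0 := by
    rw [norm_sub_sq_real, real_inner_smul_right, hi, norm_smul, mul_pow ‖(-a ^ 2)‖,
      Real.norm_eq_abs, sq_abs]
    nlinarith
  rw [← sub_eq_zero, ← norm_eq_zero]
  exact pow_eq_zero_iff two_ne_zero |>.1 (le_antisymm hs (sq_nonneg _))

theorem skew_add_apply_apply_eq_iff {A B : E →ₗ[ℝ] E} {a b : ℝ} (ha : 0 < a) (hb : 0 < b)
    (hA : ∀ x, ⟪A x, x⟫ = 0) (hAn : ∀ x, ‖A x‖ ≤ a * ‖x‖)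
    (hB : ∀ x, ⟪B x, x⟫ = 0) (hBn : ∀ x, ‖B x‖ ≤ b * ‖x‖) (x : E) :
    (A + B) ((A + B) x) = (-(a + b) ^ 2) • x ↔
      A (A x) = (-a ^ 2) • x ∧ B (B x) = (-b ^ 2) • x ∧ b • A x = a • B x := by
  constructor
  · intro h
    have hAB : ∀ y, ⟪(A + B) y, y⟫ = 0 := fun y => by
      rw [LinearMap.add_apply, inner_add_left, hA, hB, add_zero]
    have hsq : ‖A x + B x‖ ^ 2 = (a + b) ^ 2 * ‖x‖ ^ 2 := by
      have := skew_of_inner_self_eq_zero hAB ((A + B) x) x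
      rw [h, real_inner_smul_left, real_inner_self_eq_norm_sq, real_inner_self_eq_norm_sq,
        LinearMap.add_apply] at this
      linarith
    have hn : ‖A x + B x‖ = (a + b) * ‖x‖ := by
      rw [← mul_pow] at hsq
      exact (pow_left_inj₀ (norm_nonneg _) (by positivity) two_ne_zero).1 hsq
    have htri := norm_add_le (A x) (B x)
    have hAx : ‖A x‖ = a * ‖x‖ := by linarith [hAn x, hBn x]
    have hBx : ‖B x‖ = b * ‖x‖ := by linarith [hAn x, hBn x]
    refine ⟨skew_apply_apply_eq_of_norm_eq hA hAn hAx,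
      skew_apply_apply_eq_of_norm_eq hB hBn hBx, ?_⟩
    rw [norm_add_sq_real, hAx, hBx] at hsq
    have hi : ⟪A x, B x⟫ = a * b * ‖x‖ ^ 2 := by linarith
    rw [← sub_eq_zero, ← norm_eq_zero, ← pow_eq_zero_iff two_ne_zero, norm_sub_sq_real,
      real_inner_smul_left, real_inner_smul_right, hi, norm_smul, norm_smul, hAx, hBx,
      Real.norm_of_nonneg ha.le, Real.norm_of_nonneg hb.le]
    ring
  · rintro ⟨h₁, h₂, h₃⟩
    have hAB : A (B x) = (-(a * b)) • x := by
      have := congrArg A h₃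
      rw [map_smul, map_smul, h₁, smul_smul] at this
      apply smul_right_injective E ha.ne'
      simp only [← this, smul_smul]
      ring_nf
    have hBA : B (A x) = (-(a * b)) • x := by
      have := congrArg B h₃
      rw [map_smul, map_smul, h₂, smul_smul] at this
      apply smul_right_injective E hb.ne'
      simp only [this, smul_smul]
      ring_nf
    simp only [LinearMap.add_apply, map_add, h₁, h₂, hAB, hBA]
    module

end SkewPair

section Clifford

variable {z w : Type*} [NormedAddCommGroup z] [InnerProductSpace ℝ z]
  [NormedAddCommGroup w] [InnerProductSpace ℝ w] {c : z →ₗ[ℝ] w →ₗ[ℝ] w}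

theorem clifford_norm_apply (hc₁ : ∀ (Z : z) (S S' : w), ⟪c Z S, S'⟫ = -⟪S, c Z S'⟫)
    (hc₂ : ∀ (Z : z) (S : w), c Z (c Z S) = (-‖Z‖ ^ 2 : ℝ) • S) (Z : z) (S : w) :
    ‖c Z S‖ = ‖Z‖ * ‖S‖ := by
  rw [← pow_left_inj₀ (norm_nonneg _) (by positivity) two_ne_zero, ← real_inner_self_eq_norm_sq,
    hc₁, hc₂, real_inner_smul_right, real_inner_self_eq_norm_sq]
  ring

theorem clifford_K_inner_self (hc₁ : ∀ (Z : z) (S S' : w), ⟪c Z S, S'⟫ = -⟪S, c Z S'⟫)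
    (hc₂ : ∀ (Z : z) (S : w), c Z (c Z S) = (-‖Z‖ ^ 2 : ℝ) • S) {K : z →ₗ[ℝ] z} {Z₀ : z} {S : w}
    (hK : ∀ Z₁ Z₂ : z, ⟪K Z₁, Z₂⟫ = ⟪c Z₁ (c Z₀ S), c Z₂ S⟫) (Z : z) : ⟪K Z, Z⟫ = 0 := by
  have h : ⟪c Z₀ S, S⟫ = 0 := by
    have := hc₁ Z₀ S S
    rw [real_inner_comm (c Z₀ S) S] at this
    linarith
  rw [hK, hc₁, hc₂, real_inner_smul_right, h, mul_zero, neg_zero]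

theorem clifford_K_norm_le (hc₁ : ∀ (Z : z) (S S' : w), ⟪c Z S, S'⟫ = -⟪S, c Z S'⟫)
    (hc₂ : ∀ (Z : z) (S : w), c Z (c Z S) = (-‖Z‖ ^ 2 : ℝ) • S) {K : z →ₗ[ℝ] z} {Z₀ : z} {S : w}
    (hK : ∀ Z₁ Z₂ : z, ⟪K Z₁, Z₂⟫ = ⟪c Z₁ (c Z₀ S), c Z₂ S⟫) (Z : z) :
    ‖K Z‖ ≤ ‖Z₀‖ * ‖S‖ ^ 2 * ‖Z‖ := by
  have h := real_inner_le_norm (c Z (c Z₀ S)) (c (K Z) S)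
  simp only [← hK, clifford_norm_apply hc₁ hc₂, real_inner_self_eq_norm_sq] at h
  rcases (norm_nonneg (K Z)).eq_or_lt with h0 | h0
  · rw [← h0]
    positivity
  · refine le_of_mul_le_mul_right ?_ h0
    linarith

end Clifford

/-- For the direct sum of two Clifford module structures, the eigenvalue
equation `K̂(X)² Z = −‖Z₀‖²(‖S'‖² + ‖S''‖²)² Z` holds iff the two summand eigenvalue
equations hold together with the compatibility `‖S''‖² K̂'(X') Z = ‖S'‖² K̂''(X'') Z`. -/
theorem stmt_6 {z v' v'' : Type*}
    [NormedAddCommGroup z] [InnerProductSpace ℝ z] [FiniteDimensional ℝ z]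
    [NormedAddCommGroup v'] [InnerProductSpace ℝ v'] [FiniteDimensional ℝ v'] [Nontrivial v']
    [NormedAddCommGroup v''] [InnerProductSpace ℝ v''] [FiniteDimensional ℝ v''] [Nontrivial v'']
    (c' : z →ₗ[ℝ] v' →ₗ[ℝ] v')
    (hc'1 : ∀ (Z : z) (S S' : v'), ⟪c' Z S, S'⟫ = -⟪S, c' Z S'⟫)
    (hc'2 : ∀ (Z : z) (S : v'), c' Z (c' Z S) = (-‖Z‖ ^ 2 : ℝ) • S)
    (c'' : z →ₗ[ℝ] v'' →ₗ[ℝ] v'')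
    (hc''1 : ∀ (Z : z) (S S' : v''), ⟪c'' Z S, S'⟫ = -⟪S, c'' Z S'⟫)
    (hc''2 : ∀ (Z : z) (S : v''), c'' Z (c'' Z S) = (-‖Z‖ ^ 2 : ℝ) • S)
    (c : z →ₗ[ℝ] WithLp 2 (v' × v'') →ₗ[ℝ] WithLp 2 (v' × v''))
    (hc : ∀ (Z : z) (S : WithLp 2 (v' × v'')),
      c Z S = (WithLp.equiv 2 (v' × v'')).symm
        (c' Z ((WithLp.equiv 2 (v' × v'')) S).1, c'' Z ((WithLp.equiv 2 (v' × v'')) S).2))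
    (K : z × WithLp 2 (v' × v'') → z →ₗ[ℝ] z)
    (hK : ∀ (X : z × WithLp 2 (v' × v'')) (Z₁ Z₂ : z),
      ⟪K X Z₁, Z₂⟫ = ⟪c Z₁ (c X.1 X.2), c Z₂ X.2⟫)
    (K' : z × v' → z →ₗ[ℝ] z)
    (hK' : ∀ (X : z × v') (Z₁ Z₂ : z),
      ⟪K' X Z₁, Z₂⟫ = ⟪c' Z₁ (c' X.1 X.2), c' Z₂ X.2⟫)
    (K'' : z × v'' → z →ₗ[ℝ] z)
    (hK'' : ∀ (X : z × v'') (Z₁ Z₂ : z),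
      ⟪K'' X Z₁, Z₂⟫ = ⟪c'' Z₁ (c'' X.1 X.2), c'' Z₂ X.2⟫)
    (Z₀ : z) (hZ₀ : Z₀ ≠ 0) (S' : v') (hS' : S' ≠ 0) (S'' : v'') (hS'' : S'' ≠ 0) (Z : z) :
    K (Z₀, (WithLp.equiv 2 (v' × v'')).symm (S', S''))
        (K (Z₀, (WithLp.equiv 2 (v' × v'')).symm (S', S'')) Z)
      = (-(‖Z₀‖ ^ 2 * (‖S'‖ ^ 2 + ‖S''‖ ^ 2) ^ 2) : ℝ) • Z ↔
    (K' (Z₀, S') (K' (Z₀, S') Z) = (-(‖Z₀‖ ^ 2 * ‖S'‖ ^ 4) : ℝ) • Z ∧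
     K'' (Z₀, S'') (K'' (Z₀, S'') Z) = (-(‖Z₀‖ ^ 2 * ‖S''‖ ^ 4) : ℝ) • Z ∧
     (‖S''‖ ^ 2 : ℝ) • K' (Z₀, S') Z = (‖S'‖ ^ 2 : ℝ) • K'' (Z₀, S'') Z) := by
  have hsum : K (Z₀, (WithLp.equiv 2 (v' × v'')).symm (S', S'')) =
      K' (Z₀, S') + K'' (Z₀, S'') := by
    ext Z₁
    refine ext_inner_right ℝ fun Z₂ => ?_
    rw [hK, LinearMap.add_apply, inner_add_left, hK', hK'']
    simp [hc, WithLp.prod_inner_apply]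
  have hn₀ : 0 < ‖Z₀‖ := norm_pos_iff.2 hZ₀
  have hn' : 0 < ‖S'‖ := norm_pos_iff.2 hS'
  have hn'' : 0 < ‖S''‖ := norm_pos_iff.2 hS''
  have key := skew_add_apply_apply_eq_iff (a := ‖Z₀‖ * ‖S'‖ ^ 2) (b := ‖Z₀‖ * ‖S''‖ ^ 2)
    (by positivity) (by positivity)
    (clifford_K_inner_self hc'1 hc'2 (hK' (Z₀, S'))) (clifford_K_norm_le hc'1 hc'2 (hK' (Z₀, S')))
    (clifford_K_inner_self hc''1 hc''2 (hK'' (Z₀, S'')))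
    (clifford_K_norm_le hc''1 hc''2 (hK'' (Z₀, S''))) Z
  rw [mul_smul, mul_smul, (smul_right_injective z hn₀.ne').eq_iff] at key
  rw [hsum]
  convert key using 4 <;> ring_nf
end

section
/- Let ∙' and ∙'' be orthogonal Clifford module structures on v' and v'' over z, and equip v' × v'' with the product inner product and the direct-sum Clifford module structure Z ∙ (S', S'') := (Z ∙' S', Z ∙'' S''). Suppose ν = 1 is a global eigenvalue for the direct sum, i.e., for every Z₀ ∈ z with Z₀ ≠ 0 and every (S', S'') ∈ v' × v'' with (S', S'') ≠ 0 there exists a nonzero Z ∈ z with K̂((Z₀, (S', S'')))² Z = −‖Z₀‖² · (‖S'‖² + ‖S''‖²)² · Z. Then (z, v') satisfies the J²-condition: for every Z₀ ∈ z with Z₀ ≠ 0, every S' ∈ v' with S' ≠ 0, and every Z ∈ z with ⟪Z, Z₀⟫ = 0, one has K̂'((Z₀, S'))² Z = −‖Z₀‖² · ‖S'‖⁴ · Z; and likewise (z, v'') satisfies the J²-condition. -/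
open scoped RealInnerProductSpace

/-- The two axioms of an orthogonal Clifford module structure. -/
structure IsOrthogonalClifford {z w : Type*} [NormedAddCommGroup z] [InnerProductSpace ℝ z]
    [NormedAddCommGroup w] [InnerProductSpace ℝ w] (c : z →ₗ[ℝ] w →ₗ[ℝ] w) : Prop where
  skew : ∀ (Z : z) (S S' : w), ⟪c Z S, S'⟫ = -⟪S, c Z S'⟫
  sq : ∀ (Z : z) (S : w), c Z (c Z S) = (-‖Z‖ ^ 2 : ℝ) • S

namespace IsOrthogonalClifford

variable {z w : Type*} [NormedAddCommGroup z] [InnerProductSpace ℝ z]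
  [NormedAddCommGroup w] [InnerProductSpace ℝ w] {c : z →ₗ[ℝ] w →ₗ[ℝ] w}

theorem anticomm (h : IsOrthogonalClifford c) (X Y : z) (S : w) :
    c X (c Y S) = -c Y (c X S) - (2 * ⟪X, Y⟫) • S := by
  have h1 := h.sq (X + Y) S
  rw [norm_add_sq_real] at h1
  simp only [map_add, LinearMap.add_apply, h.sq X S, h.sq Y S] at h1
  rw [← sub_eq_zero] at h1 ⊢
  rw [← h1]
  module

theorem anticomm_of_inner_eq_zero (h : IsOrthogonalClifford c) {X Y : z} (hXY : ⟪X, Y⟫ = 0)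
    (S : w) : c X (c Y S) = -c Y (c X S) := by
  rw [h.anticomm, hXY]; simp

theorem inner_self_apply (h : IsOrthogonalClifford c) (X : z) (S : w) : ⟪c X S, S⟫ = 0 := by
  have h1 := h.skew X S S
  rw [real_inner_comm (c X S) S] at h1
  linarith

theorem inner_apply_apply (h : IsOrthogonalClifford c) (X Y : z) (S : w) :
    ⟪c X S, c Y S⟫ = ⟪X, Y⟫ * ‖S‖ ^ 2 := by
  have h1 := congrArg (fun T => ⟪T, S⟫) (h.anticomm X Y S)
  simp only [inner_sub_left, inner_neg_left, inner_smul_left, h.skew X (c Y S) S,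
    h.skew Y (c X S) S, real_inner_self_eq_norm_sq,
    RCLike.conj_to_real] at h1
  have h2 := real_inner_comm (c X S) (c Y S)
  linarith

theorem inner_apply_same (h : IsOrthogonalClifford c) (X : z) (S T : w) :
    ⟪c X S, c X T⟫ = ‖X‖ ^ 2 * ⟪S, T⟫ := by
  rw [h.skew, h.sq, inner_smul_right]; ring

theorem norm_sq_apply (h : IsOrthogonalClifford c) (X : z) (S : w) :
    ‖c X S‖ ^ 2 = ‖X‖ ^ 2 * ‖S‖ ^ 2 := by
  rw [← real_inner_self_eq_norm_sq, h.inner_apply_same, real_inner_self_eq_norm_sq]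

theorem eq_zero_of_apply_eq_zero (h : IsOrthogonalClifford c) {X : z} {S : w} (hS : S ≠ 0)
    (hX : c X S = 0) : X = 0 := by
  have h1 := h.norm_sq_apply X S
  rw [hX, norm_zero, zero_pow two_ne_zero, zero_eq_mul] at h1
  simpa [hS] using h1

theorem apply_ne_zero (h : IsOrthogonalClifford c) {X : z} {S : w} (hX : X ≠ 0) (hS : S ≠ 0) :
    c X S ≠ 0 := fun h0 => hX (h.eq_zero_of_apply_eq_zero hS h0)

section Relation

variable {Z₀ Z Y : z} {S : w}

theorem inner_eq_zero_of_apply_eq (h : IsOrthogonalClifford c) (hS : S ≠ 0)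
    (hZ : c Z (c Z₀ S) = c Y S) : ⟪Z, Z₀⟫ = 0 := by
  have h1 := h.inner_self_apply Y S
  rw [← hZ, h.skew, real_inner_comm, h.inner_apply_apply] at h1
  simpa [hS] using h1

theorem inner_right_eq_zero_of_apply_eq (h : IsOrthogonalClifford c) (hS : S ≠ 0)
    (hZ : c Z (c Z₀ S) = c Y S) : ⟪Y, Z₀⟫ = 0 := by
  have h1 := h.inner_self_apply Z (c Z₀ S)
  rw [hZ, h.inner_apply_apply] at h1
  simpa [hS] using h1

theorem inner_left_eq_zero_of_apply_eq (h : IsOrthogonalClifford c) (hS : S ≠ 0)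
    (hZ : c Z (c Z₀ S) = c Y S) : ⟪Y, Z⟫ = 0 := by
  have h1 := h.inner_apply_apply Y Z S
  rw [← hZ, h.inner_apply_same, h.inner_self_apply] at h1
  simpa [hS] using h1.symm

theorem apply_apply_eq_of_apply_eq (h : IsOrthogonalClifford c) (hZZ₀ : ⟪Z, Z₀⟫ = 0)
    (hYZ₀ : ⟪Y, Z₀⟫ = 0) (hZ : c Z (c Z₀ S) = c Y S) :
    c Y (c Z₀ S) = c (-(‖Z₀‖ ^ 2) • Z) S := by
  rw [h.anticomm_of_inner_eq_zero hYZ₀, ← hZ, ← h.anticomm_of_inner_eq_zero hZZ₀, h.sq]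
  simp

end Relation

/-- A maximal eigenvector of `-K²` satisfies an equation in the Clifford module. -/
theorem apply_apply_eq_of_eigenvector (h : IsOrthogonalClifford c) {Z₀ Z : z} {S : w} (hS : S ≠ 0)
    {K : z →ₗ[ℝ] z} (hK : ∀ Z₁ Z₂ : z, ⟪K Z₁, Z₂⟫ = ⟪c Z₁ (c Z₀ S), c Z₂ S⟫)
    (hZ : K (K Z) = (-(‖Z₀‖ ^ 2 * (‖S‖ ^ 2) ^ 2) : ℝ) • Z) :
    c Z (c Z₀ S) = c ((‖S‖ ^ 2)⁻¹ • K Z) S := by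
  have hN : ‖S‖ ^ 2 ≠ 0 := by simpa using hS
  have h1 : ⟪K (K Z), Z⟫ = -‖K Z‖ ^ 2 := by
    rw [hK, h.skew, h.anticomm, inner_sub_right, inner_neg_right, inner_smul_right,
      h.inner_self_apply, ← real_inner_self_eq_norm_sq, hK Z (K Z), h.skew Z (c Z₀ S)]
    ring
  rw [hZ, inner_smul_left, real_inner_self_eq_norm_sq, RCLike.conj_to_real] at h1
  rw [← sub_eq_zero, ← norm_eq_zero, ← sq_eq_zero_iff, norm_sub_sq_real, h.norm_sq_apply,
    h.norm_sq_apply, h.norm_sq_apply, ← hK, inner_smul_right, real_inner_self_eq_norm_sq,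
    norm_smul, Real.norm_eq_abs, mul_pow, sq_abs]
  have h2 : ‖K Z‖ ^ 2 = ‖Z₀‖ ^ 2 * (‖S‖ ^ 2) ^ 2 * ‖Z‖ ^ 2 := by linarith
  rw [h2]
  field_simp
  ring

end IsOrthogonalClifford

/-- At a point of maximal rank of a linear pencil of linear maps, every derivative of the pencil
sends the kernel into the range. -/
theorem LinearMap.apply_mem_range_of_finrank_range_max {V E F : Type*}
    [AddCommGroup V] [Module ℝ V] [FiniteDimensional ℝ V]
    [AddCommGroup E] [Module ℝ E]
    [NormedAddCommGroup F] [NormedSpace ℝ F] [FiniteDimensional ℝ F]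
    (B : E →ₗ[ℝ] V →ₗ[ℝ] F) {S : E}
    (hmax : ∀ T, Module.finrank ℝ (LinearMap.range (B T)) ≤
      Module.finrank ℝ (LinearMap.range (B S)))
    {x : V} (hx : B S x = 0) (T : E) : B T x ∈ LinearMap.range (B S) := by
  by_contra hnot
  set r := Module.finrank ℝ (LinearMap.range (B S)) with hr
  let b := Module.finBasis ℝ (LinearMap.range (B S))
  choose v hv using fun i => (b i).2
  have hli : LinearIndependent ℝ (Fin.cons (B T x) (fun i => B S (v i)) : Fin (r + 1) → F) := by
    rw [linearIndependent_finCons]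
    have hbv : (fun i => B S (v i)) = (fun i => ((b i : LinearMap.range (B S)) : F)) :=
      funext hv
    rw [hbv]
    refine ⟨b.linearIndependent.map' (LinearMap.range (B S)).subtype (Submodule.ker_subtype _), ?_⟩
    intro hmem
    refine hnot (Submodule.span_le.2 ?_ hmem)
    rintro _ ⟨i, rfl⟩
    exact (b i).2
  have hcont : Continuous (fun t : ℝ =>
      (Fin.cons (B T x) (fun i => B S (v i) + t • B T (v i)) : Fin (r + 1) → F)) := by
    refine continuous_pi fun i => ?_
    refine Fin.cases ?_ (fun i => ?_) i
    · simpa using continuous_const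
    · simp only [Fin.cons_succ]
      fun_prop
  have hopen := isOpen_setOfPred_linearIndependent (𝕜 := ℝ) (E := F) (ι := Fin (r + 1))
  have hev : ∀ᶠ t : ℝ in nhds 0, LinearIndependent ℝ
      (Fin.cons (B T x) (fun i => B S (v i) + t • B T (v i)) : Fin (r + 1) → F) :=
    hcont.continuousAt.eventually_mem (hopen.mem_nhds (by simpa using hli))
  obtain ⟨t, ht, ht0⟩ := ((hev.filter_mono nhdsWithin_le_nhds).and
    (self_mem_nhdsWithin : ({0}ᶜ : Set ℝ) ∈ nhdsWithin 0 {0}ᶜ)).exists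
  have hsub : Submodule.span ℝ (Set.range
      (Fin.cons (B T x) (fun i => B S (v i) + t • B T (v i)) : Fin (r + 1) → F)) ≤
      LinearMap.range (B (S + t • T)) := by
    rw [Submodule.span_le]
    rintro _ ⟨i, rfl⟩
    refine Fin.cases ?_ (fun i => ?_) i
    · refine ⟨t⁻¹ • x, ?_⟩
      simp [hx, smul_smul, inv_mul_cancel₀ (show t ≠ 0 from ht0)]
    · exact ⟨v i, by simp⟩
  have h1 := Submodule.finrank_mono hsub
  rw [finrank_span_eq_card ht, Fintype.card_fin] at h1
  have h2 := hmax (S + t • T)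
  omega

namespace IsOrthogonalClifford

variable {z v' v'' : Type*}
  [NormedAddCommGroup z] [InnerProductSpace ℝ z] [FiniteDimensional ℝ z]
  [NormedAddCommGroup v'] [InnerProductSpace ℝ v']
  [NormedAddCommGroup v''] [InnerProductSpace ℝ v''] [FiniteDimensional ℝ v''] [Nontrivial v'']
  {c' : z →ₗ[ℝ] v' →ₗ[ℝ] v'} {c'' : z →ₗ[ℝ] v'' →ₗ[ℝ] v''}

theorem exists_apply_apply_eq_of_common_solution (h' : IsOrthogonalClifford c')
    (h'' : IsOrthogonalClifford c'') {Z₀ : z} (hZ₀ : Z₀ ≠ 0) {S' : v'} (hS' : S' ≠ 0)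
    (H : ∀ S'' : v'', ∃ Z : z, Z ≠ 0 ∧ ∃ Y : z,
      c' Z (c' Z₀ S') = c' Y S' ∧ c'' Z (c'' Z₀ S'') = c'' Y S'')
    {Z : z} (hZ : ⟪Z, Z₀⟫ = 0) : ∃ Y : z, c' Z (c' Z₀ S') = c' Y S' := by
  let P : z × z →ₗ[ℝ] v' := (c'.flip (c' Z₀ S')).coprod (-c'.flip S')
  let V : Submodule ℝ (z × z) := LinearMap.ker P
  have memV : ∀ p : z × z, p ∈ V ↔ c' p.1 (c' Z₀ S') = c' p.2 S' := fun p => by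
    simp [V, P, LinearMap.mem_ker, ← sub_eq_add_neg, sub_eq_zero]
  let B : v'' →ₗ[ℝ] V →ₗ[ℝ] v'' :=
    LinearMap.mk₂ ℝ (fun S p => c'' p.1.1 (c'' Z₀ S) - c'' p.1.2 S)
      (fun _ _ _ => by simp only [map_add]; abel)
      (fun _ _ _ => by simp only [map_smul, smul_sub])
      (fun _ _ _ => by
        simp only [Submodule.coe_add, Prod.fst_add, Prod.snd_add, map_add, LinearMap.add_apply]
        abel)
      (fun _ _ _ => by
        simp only [Submodule.coe_smul, Prod.smul_fst, Prod.smul_snd, map_smul,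
          LinearMap.smul_apply, smul_sub])
  have hB : ∀ S p, B S p = c'' p.1.1 (c'' Z₀ S) - c'' p.1.2 S := fun _ _ => rfl
  obtain ⟨S, hS, hmax⟩ : ∃ S : v'', S ≠ 0 ∧ ∀ T,
      Module.finrank ℝ (LinearMap.range (B T)) ≤ Module.finrank ℝ (LinearMap.range (B S)) := by
    have hfin : (Set.range fun S => Module.finrank ℝ (LinearMap.range (B S))).Finite :=
      (Set.finite_Iic (Module.finrank ℝ v'')).subset
        (by rintro _ ⟨S, rfl⟩; exact Submodule.finrank_le _)
    obtain ⟨_, ⟨S, rfl⟩, hS⟩ := Set.exists_max_image _ id hfin (Set.range_nonempty _)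
    have hS : ∀ T, Module.finrank ℝ (LinearMap.range (B T)) ≤
        Module.finrank ℝ (LinearMap.range (B S)) := fun T => hS _ ⟨T, rfl⟩
    by_cases h0 : S = 0
    · obtain ⟨S₁, hS₁⟩ := exists_ne (0 : v'')
      refine ⟨S₁, hS₁, fun T => (hS T).trans ?_⟩
      rw [h0, map_zero, LinearMap.range_zero, finrank_bot]
      exact Nat.zero_le _
    · exact ⟨S, h0, hS⟩
  obtain ⟨X, hX, Y, hXY', hXY⟩ := H S
  have hXZ₀ := h'.inner_eq_zero_of_apply_eq hS' hXY'
  have hYZ₀ := h'.inner_right_eq_zero_of_apply_eq hS' hXY'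
  have hYX := h'.inner_left_eq_zero_of_apply_eq hS' hXY'
  have hY : Y ≠ 0 := by
    rintro rfl
    exact h'.apply_ne_zero hX (h'.apply_ne_zero hZ₀ hS') (by simpa using hXY')
  let p : V := ⟨(X, Y), (memV _).2 hXY'⟩
  let q : V := ⟨(Y, -(‖Z₀‖ ^ 2) • X),
    (memV _).2 (h'.apply_apply_eq_of_apply_eq hXZ₀ hYZ₀ hXY')⟩
  have hp : B S p = 0 := sub_eq_zero.2 hXY
  have hq : B S q = 0 := sub_eq_zero.2 (h''.apply_apply_eq_of_apply_eq hXZ₀ hYZ₀ hXY)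
  have hpq : LinearIndependent ℝ ![p, q] := by
    rw [LinearIndependent.pair_iff]
    intro s t hst
    have h1 : s • X + t • Y = 0 := congrArg (fun u : V => u.1.1) hst
    have hs := congrArg (fun u => ⟪u, X⟫) h1
    have ht := congrArg (fun u => ⟪u, Y⟫) h1
    simp only [inner_add_left, inner_smul_left, hYX, real_inner_comm Y X,
      real_inner_self_eq_norm_sq, inner_zero_left, RCLike.conj_to_real] at hs ht
    exact ⟨by simpa [hX] using hs, by simpa [hY] using ht⟩
  have hker : 2 ≤ Module.finrank ℝ (LinearMap.ker (B S)) := by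
    have h1 : Submodule.span ℝ (Set.range ![p, q]) ≤ LinearMap.ker (B S) := by
      rw [Submodule.span_le]
      rintro _ ⟨i, rfl⟩
      fin_cases i
      · exact hp
      · exact hq
    have h2 := Submodule.finrank_mono h1
    rwa [finrank_span_eq_card hpq, Fintype.card_fin] at h2
  let W : Submodule ℝ z := Submodule.span ℝ (Set.range ![Z₀, X, Y])
  have hW : Module.finrank ℝ W ≤ 3 := by
    exact (finrank_range_le_card (R := ℝ) ![Z₀, X, Y]).trans_eq (Fintype.card_fin 3)
  have hWperp := W.finrank_add_finrank_orthogonal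
  have hrange : Module.finrank ℝ Wᗮ ≤ Module.finrank ℝ (LinearMap.range (B S)) := by
    let f : Wᗮ →ₗ[ℝ] v'' := (c''.flip (c'' Y S)).comp Wᗮ.subtype
    have hf : Function.Injective f := by
      rw [← LinearMap.ker_eq_bot, LinearMap.ker_eq_bot']
      intro U hU
      exact Subtype.ext (h''.eq_zero_of_apply_eq_zero (h''.apply_ne_zero hY hS) hU)
    rw [← LinearMap.finrank_range_of_inj hf]
    refine Submodule.finrank_mono ?_
    rintro _ ⟨U, rfl⟩
    have hU : ∀ i, ⟪(![Z₀, X, Y] i : z), (U : z)⟫ = 0 := fun i =>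
      (Submodule.mem_orthogonal _ _).1 U.2 _ (Submodule.subset_span ⟨i, rfl⟩)
    have hU0 : ⟪Z₀, (U : z)⟫ = 0 := hU 0
    have hU1 : ⟪X, (U : z)⟫ = 0 := hU 1
    have hU2 : ⟪Y, (U : z)⟫ = 0 := hU 2
    have h1 := B.apply_mem_range_of_finrank_range_max hmax hp (c'' U S)
    have h2 : B (c'' U S) p = (2 : ℝ) • f U := by
      change c'' X (c'' Z₀ (c'' U S)) - c'' Y (c'' U S) = (2 : ℝ) • c'' U (c'' Y S)
      rw [h''.anticomm_of_inner_eq_zero hU0, map_neg, h''.anticomm_of_inner_eq_zero hU1,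
        h''.anticomm_of_inner_eq_zero hU2, hXY, two_smul]
      abel
    rw [h2] at h1
    exact ((LinearMap.range (B S)).smul_mem_iff two_ne_zero).1 h1
  have hrn := LinearMap.finrank_range_add_finrank_ker (B S)
  let N : Submodule ℝ z := (ℝ ∙ Z₀)ᗮ
  have hN : Module.finrank ℝ (ℝ ∙ Z₀) + Module.finrank ℝ N = Module.finrank ℝ z :=
    (ℝ ∙ Z₀).finrank_add_finrank_orthogonal
  rw [finrank_span_singleton hZ₀] at hN
  have memN : ∀ u : z, u ∈ N ↔ ⟪u, Z₀⟫ = 0 := fun u =>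
    Submodule.mem_orthogonal_singleton_iff_inner_left
  let g : V →ₗ[ℝ] N := ((LinearMap.fst ℝ z z).comp V.subtype).codRestrict N fun u =>
    (memN _).2 (h'.inner_eq_zero_of_apply_eq hS' ((memV u).1 u.2))
  have hg : Function.Injective g := by
    rw [← LinearMap.ker_eq_bot, LinearMap.ker_eq_bot']
    intro u hu
    have h1 : u.1.1 = 0 := congrArg Subtype.val hu
    have h2 := (memV u).1 u.2
    rw [h1, map_zero, LinearMap.zero_apply] at h2
    exact Subtype.ext (Prod.ext h1 (h'.eq_zero_of_apply_eq_zero hS' h2.symm))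
  have hdim : Module.finrank ℝ V = Module.finrank ℝ N :=
    le_antisymm (LinearMap.finrank_le_finrank_of_injective hg) (by omega)
  obtain ⟨u, hu⟩ := (LinearMap.injective_iff_surjective_of_finrank_eq_finrank hdim).1 hg
    ⟨Z, (memN Z).2 hZ⟩
  refine ⟨u.1.2, ?_⟩
  rw [← (memV u).1 u.2]
  exact congrArg (fun n : N => c' n.1 (c' Z₀ S')) hu.symm

theorem map_map_eq_of_common_solution (h' : IsOrthogonalClifford c')
    (h'' : IsOrthogonalClifford c'') {Z₀ : z} (hZ₀ : Z₀ ≠ 0) {S' : v'} (hS' : S' ≠ 0)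
    (H : ∀ S'' : v'', ∃ Z : z, Z ≠ 0 ∧ ∃ Y : z,
      c' Z (c' Z₀ S') = c' Y S' ∧ c'' Z (c'' Z₀ S'') = c'' Y S'')
    {K : z →ₗ[ℝ] z} (hK : ∀ Z₁ Z₂ : z, ⟪K Z₁, Z₂⟫ = ⟪c' Z₁ (c' Z₀ S'), c' Z₂ S'⟫)
    {Z : z} (hZ : ⟪Z, Z₀⟫ = 0) : K (K Z) = (-(‖Z₀‖ ^ 2 * ‖S'‖ ^ 4) : ℝ) • Z := by
  obtain ⟨Y, hY⟩ := h'.exists_apply_apply_eq_of_common_solution h'' hZ₀ hS' H hZ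
  have hYZ₀ := h'.inner_right_eq_zero_of_apply_eq hS' hY
  have hKZ : K Z = ‖S'‖ ^ 2 • Y := ext_inner_right ℝ fun u => by
    rw [hK, hY, h'.inner_apply_apply, inner_smul_left, RCLike.conj_to_real, mul_comm]
  have hKY : K Y = (-(‖Z₀‖ ^ 2 * ‖S'‖ ^ 2)) • Z := ext_inner_right ℝ fun u => by
    rw [hK, h'.apply_apply_eq_of_apply_eq hZ hYZ₀ hY, h'.inner_apply_apply, inner_smul_left,
      inner_smul_left, RCLike.conj_to_real, RCLike.conj_to_real]
    ring
  rw [hKZ, map_smul, hKY, smul_smul]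
  congr 1
  ring

end IsOrthogonalClifford

/-- If `ν = 1` is a global eigenvalue of `−Ǩ²` for the direct sum of two
orthogonal Clifford module structures, then both summands satisfy the `J²`-condition. -/
theorem stmt_7 {z v' v'' : Type*}
    [NormedAddCommGroup z] [InnerProductSpace ℝ z] [FiniteDimensional ℝ z]
    [NormedAddCommGroup v'] [InnerProductSpace ℝ v'] [FiniteDimensional ℝ v'] [Nontrivial v']
    [NormedAddCommGroup v''] [InnerProductSpace ℝ v''] [FiniteDimensional ℝ v''] [Nontrivial v'']
    (c' : z →ₗ[ℝ] v' →ₗ[ℝ] v')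
    (hc'1 : ∀ (Z : z) (S S' : v'), ⟪c' Z S, S'⟫ = -⟪S, c' Z S'⟫)
    (hc'2 : ∀ (Z : z) (S : v'), c' Z (c' Z S) = (-‖Z‖ ^ 2 : ℝ) • S)
    (c'' : z →ₗ[ℝ] v'' →ₗ[ℝ] v'')
    (hc''1 : ∀ (Z : z) (S S' : v''), ⟪c'' Z S, S'⟫ = -⟪S, c'' Z S'⟫)
    (hc''2 : ∀ (Z : z) (S : v''), c'' Z (c'' Z S) = (-‖Z‖ ^ 2 : ℝ) • S)
    (c : z →ₗ[ℝ] WithLp 2 (v' × v'') →ₗ[ℝ] WithLp 2 (v' × v''))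
    (hc : ∀ (Z : z) (S : WithLp 2 (v' × v'')),
      c Z S = (WithLp.equiv 2 (v' × v'')).symm
        (c' Z ((WithLp.equiv 2 (v' × v'')) S).1, c'' Z ((WithLp.equiv 2 (v' × v'')) S).2))
    (K : z × WithLp 2 (v' × v'') → z →ₗ[ℝ] z)
    (hK : ∀ (X : z × WithLp 2 (v' × v'')) (Z₁ Z₂ : z),
      ⟪K X Z₁, Z₂⟫ = ⟪c Z₁ (c X.1 X.2), c Z₂ X.2⟫)
    (K' : z × v' → z →ₗ[ℝ] z)
    (hK' : ∀ (X : z × v') (Z₁ Z₂ : z),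
      ⟪K' X Z₁, Z₂⟫ = ⟪c' Z₁ (c' X.1 X.2), c' Z₂ X.2⟫)
    (K'' : z × v'' → z →ₗ[ℝ] z)
    (hK'' : ∀ (X : z × v'') (Z₁ Z₂ : z),
      ⟪K'' X Z₁, Z₂⟫ = ⟪c'' Z₁ (c'' X.1 X.2), c'' Z₂ X.2⟫)
    (hglobal : ∀ (Z₀ : z), Z₀ ≠ 0 → ∀ (S' : v') (S'' : v''), (S', S'') ≠ (0, 0) →
      ∃ Z : z, Z ≠ 0 ∧
        K (Z₀, (WithLp.equiv 2 (v' × v'')).symm (S', S''))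
            (K (Z₀, (WithLp.equiv 2 (v' × v'')).symm (S', S'')) Z)
          = (-(‖Z₀‖ ^ 2 * (‖S'‖ ^ 2 + ‖S''‖ ^ 2) ^ 2) : ℝ) • Z) :
    (∀ (Z₀ : z), Z₀ ≠ 0 → ∀ (S' : v'), S' ≠ 0 → ∀ Z : z, ⟪Z, Z₀⟫ = 0 →
      K' (Z₀, S') (K' (Z₀, S') Z) = (-(‖Z₀‖ ^ 2 * ‖S'‖ ^ 4) : ℝ) • Z) ∧
    (∀ (Z₀ : z), Z₀ ≠ 0 → ∀ (S'' : v''), S'' ≠ 0 → ∀ Z : z, ⟪Z, Z₀⟫ = 0 →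
      K'' (Z₀, S'') (K'' (Z₀, S'') Z) = (-(‖Z₀‖ ^ 2 * ‖S''‖ ^ 4) : ℝ) • Z) := by
  have h' : IsOrthogonalClifford c' := ⟨hc'1, hc'2⟩
  have h'' : IsOrthogonalClifford c'' := ⟨hc''1, hc''2⟩
  have h : IsOrthogonalClifford c := by
    refine ⟨fun Z S T => ?_, fun Z S => ?_⟩
    · simp only [hc, WithLp.prod_inner_apply, WithLp.equiv_apply, WithLp.equiv_symm_apply,
        hc'1, hc''1]
      ring
    · simp only [hc, WithLp.equiv_apply, WithLp.equiv_symm_apply, hc'2, hc''2]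
      rfl
  have H : ∀ Z₀ : z, Z₀ ≠ 0 → ∀ (S' : v') (S'' : v''), (S', S'') ≠ (0, 0) →
      ∃ Z : z, Z ≠ 0 ∧ ∃ Y : z,
        c' Z (c' Z₀ S') = c' Y S' ∧ c'' Z (c'' Z₀ S'') = c'' Y S'' := by
    intro Z₀ hZ₀ S' S'' hne
    obtain ⟨Z, hZ, hKZ⟩ := hglobal Z₀ hZ₀ S' S'' hne
    set S := (WithLp.equiv 2 (v' × v'')).symm (S', S'') with hSdef
    have hS : S ≠ 0 := fun h0 => hne (congrArg (WithLp.equiv 2 (v' × v'')) h0)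
    have hnorm : ‖S‖ ^ 2 = ‖S'‖ ^ 2 + ‖S''‖ ^ 2 := WithLp.prod_norm_sq_eq_of_L2 S
    rw [← hnorm] at hKZ
    have h1 := h.apply_apply_eq_of_eigenvector hS (hK (Z₀, S)) hKZ
    refine ⟨Z, hZ, (‖S‖ ^ 2)⁻¹ • K (Z₀, S) Z, ?_, ?_⟩
    · simpa only [hc, hSdef, Equiv.apply_symm_apply] using
        congrArg (fun T => (WithLp.equiv 2 (v' × v'') T).1) h1
    · simpa only [hc, hSdef, Equiv.apply_symm_apply] using
        congrArg (fun T => (WithLp.equiv 2 (v' × v'') T).2) h1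
  refine ⟨fun Z₀ hZ₀ S' hS' Z hZ => ?_, fun Z₀ hZ₀ S'' hS'' Z hZ => ?_⟩
  · exact h'.map_map_eq_of_common_solution h'' hZ₀ hS'
      (fun S'' => H Z₀ hZ₀ S' S'' fun h0 => hS' (congrArg Prod.fst h0)) (hK' (Z₀, S')) hZ
  · refine h''.map_map_eq_of_common_solution h' hZ₀ hS'' (fun S' => ?_) (hK'' (Z₀, S'')) hZ
    obtain ⟨X, hX, Y, h1, h2⟩ := H Z₀ hZ₀ S' S'' fun h0 => hS'' (congrArg Prod.snd h0)
    exact ⟨X, hX, Y, h2, h1⟩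
end

section
/- Let 𝔤 be a finite-dimensional real Lie algebra equipped with an inner product, and for A ∈ 𝔤 let ad(A)* denote the adjoint, with respect to the inner product, of the linear map ad(A) = [A, ·]. Define ∇ : 𝔤 × 𝔤 → 𝔤 by ∇_X Y := (1/2)·([X, Y] − ad(X)* Y − ad(Y)* X), and define R(X, Y)Z := ∇_X(∇_Y Z) − ∇_Y(∇_X Z) − ∇_{[X,Y]} Z. Then for all X, Y ∈ 𝔤: ⟪R(Y, X)X, Y⟫ = −(3/4)·‖[X, Y]‖² − ⟪ad(X)* X, ad(Y)* Y⟫ + (1/4)·‖ad(X)* Y + ad(Y)* X‖² + (1/2)·(⟪[[X, Y], X], Y⟫ + ⟪[[Y, X], Y], X⟫). -/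
open scoped RealInnerProductSpace

/-- The symmetrized curvature formula for a left-invariant metric on a Lie
group, expressed algebraically on the metric Lie algebra `(𝔤, ⟪·,·⟫)`:
`⟪R(Y,X)X, Y⟫ = −(3/4)‖[X,Y]‖² − ⟪ad(X)*X, ad(Y)*Y⟫ + (1/4)‖ad(X)*Y + ad(Y)*X‖²
  + (1/2)(⟪[[X,Y],X], Y⟫ + ⟪[[Y,X],Y], X⟫)`. -/
theorem stmt_10 {g : Type*} [NormedAddCommGroup g] [InnerProductSpace ℝ g]
    [FiniteDimensional ℝ g]
    (br : g →ₗ[ℝ] g →ₗ[ℝ] g)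
    (halt : ∀ X : g, br X X = 0)
    (hjac : ∀ X Y Z : g, br X (br Y Z) + br Y (br Z X) + br Z (br X Y) = 0)
    (adStar : g → g →ₗ[ℝ] g)
    (hadStar : ∀ A : g, adStar A = LinearMap.adjoint (br A))
    (nabla : g → g → g)
    (hnabla : ∀ X Y : g, nabla X Y = (1/2 : ℝ) • (br X Y - adStar X Y - adStar Y X))
    (Rm : g → g → g → g)
    (hRm : ∀ X Y Z : g,
      Rm X Y Z = nabla X (nabla Y Z) - nabla Y (nabla X Z) - nabla (br X Y) Z) :
    ∀ X Y : g,
      ⟪Rm Y X X, Y⟫ =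
        -(3/4) * ‖br X Y‖ ^ 2 - ⟪adStar X X, adStar Y Y⟫
          + (1/4) * ‖adStar X Y + adStar Y X‖ ^ 2
          + (1/2) * (⟪br (br X Y) X, Y⟫ + ⟪br (br Y X) Y, X⟫) := by
  intro X Y
  have hadj : ∀ A B C : g, ⟪adStar A B, C⟫ = ⟪B, br A C⟫ := fun A B C => by
    rw [hadStar, LinearMap.adjoint_inner_left]
  have hanti : ∀ A B : g, br A B = -br B A := fun A B => by
    have h := halt (A + B)
    simp only [map_add, LinearMap.add_apply, halt, zero_add, add_zero] at h
    exact eq_neg_of_add_eq_zero_right h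
  have koszul : ∀ A B C : g,
      ⟪nabla A B, C⟫ = (1/2) * (⟪br A B, C⟫ - ⟪B, br A C⟫ - ⟪A, br B C⟫) := fun A B C => by
    rw [hnabla, real_inner_smul_left, inner_sub_left, inner_sub_left, hadj, hadj]
  have hskew : ∀ A B C : g, ⟪nabla A B, C⟫ = -⟪B, nabla A C⟫ := fun A B C => by
    rw [← real_inner_comm B, koszul, koszul, hanti C B, inner_neg_right,
      real_inner_comm B (br A C), real_inner_comm C (br A B)]
    ring
  have hself : ∀ A : g, nabla A A = -adStar A A := fun A => by
    rw [hnabla, halt]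
    module
  have hmixed : ⟪nabla Y X, nabla X Y⟫ =
      (1/4) * ‖adStar X Y + adStar Y X‖ ^ 2 - (1/4) * ‖br X Y‖ ^ 2 := by
    rw [hnabla, hnabla, hanti Y X, ← real_inner_self_eq_norm_sq, ← real_inner_self_eq_norm_sq]
    simp only [real_inner_smul_left, real_inner_smul_right, inner_sub_left, inner_sub_right,
      inner_add_left, inner_add_right, inner_neg_left, inner_neg_right, real_inner_comm (br X Y)]
    ring
  rw [hRm, inner_sub_left, inner_sub_left, hskew Y (nabla X X), hskew X (nabla Y X), hself X, hself Y, hmixed,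
    koszul, hanti Y X, inner_neg_neg, ← real_inner_self_eq_norm_sq (br X Y)]
  simp only [map_neg, LinearMap.neg_apply, inner_neg_left, inner_neg_right,
    real_inner_comm X (br (br X Y) Y)]
  ring
end

section
/- Let ∙ be an orthogonal Clifford module structure on v over z with spinor product ∗, and set 𝔫 := z × v. For X = (X_z, X_v), Y = (Y_z, Y_v) ∈ 𝔫 define [X, Y] := (X_v ∗ Y_v, 0), ∇_X Y := ((1/2)·(X_v ∗ Y_v), −(1/2)·(X_z ∙ Y_v + Y_z ∙ X_v)), and R(X, Y)Z := ∇_X(∇_Y Z) − ∇_Y(∇_X Z) − ∇_{[X,Y]} Z. Then for all X, Y ∈ 𝔫: R(Y, X)X = ( (1/4)·‖X_v‖²·Y_z + (1/2)·⟪X_v, Y_v⟫·X_z − (3/4)·(Y_v ∗ (X_z ∙ X_v)), −(3/4)·((X_v ∗ Y_v) ∙ X_v) + (1/4)·‖X_z‖²·Y_v + (3/4)·(Y_z ∙ (X_z ∙ X_v)) + (1/2)·⟪X_z, Y_z⟫·X_v ). -/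
open scoped RealInnerProductSpace

section CliffordModule

variable {z v : Type*}
  [NormedAddCommGroup z] [InnerProductSpace ℝ z]
  [NormedAddCommGroup v] [InnerProductSpace ℝ v]

/-- Polarization of `Z ∙ (Z ∙ S) = -‖Z‖² S`. -/
theorem clifford_mul_add_swap {c : z →ₗ[ℝ] v →ₗ[ℝ] v}
    (hc : ∀ (Z : z) (S : v), c Z (c Z S) = (-‖Z‖ ^ 2 : ℝ) • S) (Z W : z) (S : v) :
    c Z (c W S) + c W (c Z S) = (-(2 * ⟪Z, W⟫)) • S := by
  have h := hc (Z + W) S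
  simp only [map_add, LinearMap.add_apply, hc, norm_add_sq_real] at h
  linear_combination (norm := module) h

/-- The spinor product is antisymmetric. -/
theorem spinorProduct_swap {c : z →ₗ[ℝ] v →ₗ[ℝ] v}
    (hc : ∀ (Z : z) (S S' : v), ⟪c Z S, S'⟫ = -⟪S, c Z S'⟫) {sp : v →ₗ[ℝ] v →ₗ[ℝ] z}
    (hsp : ∀ (Z : z) (S S' : v), ⟪Z, sp S S'⟫ = ⟪c Z S, S'⟫) (S T : v) :
    sp S T = -sp T S := by
  refine ext_inner_left ℝ fun U => ?_
  rw [inner_neg_right, hsp, hsp, hc, real_inner_comm]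

theorem spinorProduct_clifford_add_swap {c : z →ₗ[ℝ] v →ₗ[ℝ] v}
    (hc1 : ∀ (Z : z) (S S' : v), ⟪c Z S, S'⟫ = -⟪S, c Z S'⟫)
    (hc2 : ∀ (Z : z) (S : v), c Z (c Z S) = (-‖Z‖ ^ 2 : ℝ) • S)
    {sp : v →ₗ[ℝ] v →ₗ[ℝ] z}
    (hsp : ∀ (Z : z) (S S' : v), ⟪Z, sp S S'⟫ = ⟪c Z S, S'⟫) (Z : z) (S T : v) :
    sp S (c Z T) + sp T (c Z S) = (2 * ⟪S, T⟫) • Z := by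
  refine ext_inner_left ℝ fun U => ?_
  have h := congrArg (fun x => ⟪S, x⟫) (clifford_mul_add_swap hc2 U Z T)
  simp only [inner_add_right, inner_smul_right] at h
  rw [inner_add_right, hsp, hsp, inner_smul_right, hc1, real_inner_comm (c Z S), hc1]
  linear_combination -h

end CliffordModule

/-- The symmetrized curvature tensor of an H-type group. With
`∇_X Y = ((1/2)(X_v ∗ Y_v), −(1/2)(X_z ∙ Y_v + Y_z ∙ X_v))` and the bracket
`[X, Y] = (X_v ∗ Y_v, 0)` on `𝔫 = z × v`, the curvature `R(Y,X)X` is given by the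
explicit H-type formula. -/
theorem stmt_11 {z v : Type*}
    [NormedAddCommGroup z] [InnerProductSpace ℝ z] [FiniteDimensional ℝ z]
    [NormedAddCommGroup v] [InnerProductSpace ℝ v] [FiniteDimensional ℝ v]
    [Nontrivial v]
    (c : z →ₗ[ℝ] v →ₗ[ℝ] v)
    (hc1 : ∀ (Z : z) (S S' : v), ⟪c Z S, S'⟫ = -⟪S, c Z S'⟫)
    (hc2 : ∀ (Z : z) (S : v), c Z (c Z S) = (-‖Z‖ ^ 2 : ℝ) • S)
    (sp : v →ₗ[ℝ] v →ₗ[ℝ] z)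
    (hsp : ∀ (Z : z) (S S' : v), ⟪Z, sp S S'⟫ = ⟪c Z S, S'⟫)
    (nabla : z × v → z × v → z × v)
    (hnabla : ∀ X Y : z × v,
      nabla X Y = ((1/2 : ℝ) • sp X.2 Y.2, -((1/2 : ℝ) • (c X.1 Y.2 + c Y.1 X.2))))
    (Rm : z × v → z × v → z × v → z × v)
    (hRm : ∀ X Y W : z × v,
      Rm X Y W = nabla X (nabla Y W) - nabla Y (nabla X W) - nabla (sp X.2 Y.2, (0 : v)) W) :
    ∀ X Y : z × v,
      Rm Y X X =
        ((1/4 * ‖X.2‖ ^ 2) • Y.1 + (1/2 * ⟪X.2, Y.2⟫) • X.1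
            - (3/4 : ℝ) • sp Y.2 (c X.1 X.2),
         -((3/4 : ℝ) • c (sp X.2 Y.2) X.2) + (1/4 * ‖X.1‖ ^ 2) • Y.2
            + (3/4 : ℝ) • c Y.1 (c X.1 X.2) + (1/2 * ⟪X.1, Y.1⟫) • X.2) := by
  rintro ⟨W, S⟩ ⟨U, T⟩
  have hSS : sp S S = 0 := by
    linear_combination (norm := module) (1 / 2 : ℝ) • spinorProduct_swap hc1 hsp S S
  have hTS := spinorProduct_swap hc1 hsp T S
  have hST := spinorProduct_clifford_add_swap hc1 hc2 hsp W S T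
  have hSU := spinorProduct_clifford_add_swap hc1 hc2 hsp U S S
  have hWU := clifford_mul_add_swap hc2 W U S
  have hWW := hc2 W T
  rw [real_inner_self_eq_norm_sq] at hSU
  rw [hRm]
  simp only [hnabla, hSS, hTS, map_add, map_neg, map_smul, map_zero,
    LinearMap.neg_apply, LinearMap.smul_apply, LinearMap.zero_apply, Prod.mk_sub_mk]
  refine Prod.ext ?_ ?_ <;> dsimp only
  · linear_combination (norm := module) (1 / 8 : ℝ) • hSU + (1 / 4 : ℝ) • hST
  · linear_combination (norm := module) (-1 / 4 : ℝ) • hWU - (1 / 4 : ℝ) • hWW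
end

section
/- Let ∙ be an orthogonal Clifford module structure on v over z with spinor product ∗, and let X_z ∈ z with X_z ≠ 0 and X_v ∈ v. Define X : ℝ → z × v by X(t) := (X_z, cos(t·‖X_z‖)·X_v + (sin(t·‖X_z‖)/‖X_z‖)·(X_z ∙ X_v)), and write X_v(t) for the v-component of X(t). Then for every t ∈ ℝ the derivative of X at t exists and equals (0, X_z ∙ X_v(t)) = −∇_{X(t)} X(t), where ∇_A B := ((1/2)·(A_v ∗ B_v), −(1/2)·(A_z ∙ B_v + B_z ∙ A_v)) for A = (A_z, A_v), B = (B_z, B_v) ∈ z × v; that is, X satisfies the left-invariant geodesic equation X'(t) + ∇_{X(t)} X(t) = 0. Moreover ‖X_v(t)‖ = ‖X_v‖ for all t ∈ ℝ. -/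
open scoped RealInnerProductSpace

/-- A skew-symmetric bilinear action has vanishing diagonal pairing. -/
theorem inner_apply_self_eq_zero_of_skew {v : Type*} [NormedAddCommGroup v]
    [InnerProductSpace ℝ v] {J : v →ₗ[ℝ] v} (hJ : ∀ S S' : v, ⟪J S, S'⟫ = -⟪S, J S'⟫) (S : v) :
    ⟪J S, S⟫ = 0 := by
  have h := hJ S S
  rw [real_inner_comm (J S) S] at h
  linarith

/-- If `J` is skew-symmetric with `J² = -r²`, then `J` scales norms by `r`. -/
theorem norm_sq_apply_of_skew {v : Type*} [NormedAddCommGroup v]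
    [InnerProductSpace ℝ v] {J : v →ₗ[ℝ] v} {r : ℝ} (hJ : ∀ S S' : v, ⟪J S, S'⟫ = -⟪S, J S'⟫)
    (hJ2 : ∀ S, J (J S) = (-r ^ 2) • S) (S : v) :
    ‖J S‖ ^ 2 = r ^ 2 * ‖S‖ ^ 2 := by
  rw [← real_inner_self_eq_norm_sq, hJ, hJ2, real_inner_smul_right, real_inner_self_eq_norm_sq]
  ring

/-- If `J² = -r²` with `r ≠ 0`, then `cos (t r) S + (sin (t r) / r) J S` solves `Y' = J Y`. -/
theorem hasDerivAt_cos_smul_add_sin_smul {v : Type*} [NormedAddCommGroup v]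
    [InnerProductSpace ℝ v] {J : v →ₗ[ℝ] v} {r : ℝ} (hr : r ≠ 0)
    (hJ2 : ∀ S, J (J S) = (-r ^ 2) • S) (S : v) (t : ℝ) :
    HasDerivAt (fun t : ℝ => Real.cos (t * r) • S + (Real.sin (t * r) / r) • J S)
      (J (Real.cos (t * r) • S + (Real.sin (t * r) / r) • J S)) t := by
  have hmul : HasDerivAt (fun t : ℝ => t * r) r t := hasDerivAt_mul_const r
  refine ((hmul.cos.smul_const S).add ((hmul.sin.div_const r).smul_const (J S))).congr_deriv ?_
  rw [map_add, map_smul, map_smul, hJ2, smul_smul, mul_div_cancel_right₀ _ hr, add_comm]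
  congr 2
  field_simp

/-- If `J` is skew-symmetric with `J² = -r²` and `r ≠ 0`, then `cos (t r) S + (sin (t r) / r) J S`
has the norm of `S`. -/
theorem norm_cos_smul_add_sin_smul {v : Type*} [NormedAddCommGroup v]
    [InnerProductSpace ℝ v] {J : v →ₗ[ℝ] v} {r : ℝ} (hr : r ≠ 0)
    (hJ : ∀ S S' : v, ⟪J S, S'⟫ = -⟪S, J S'⟫) (hJ2 : ∀ S, J (J S) = (-r ^ 2) • S)
    (S : v) (t : ℝ) :
    ‖Real.cos (t * r) • S + (Real.sin (t * r) / r) • J S‖ = ‖S‖ := by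
  rw [← sq_eq_sq₀ (norm_nonneg _) (norm_nonneg _), norm_add_sq_real, norm_smul, norm_smul,
    mul_pow, mul_pow, norm_sq_apply_of_skew hJ hJ2, real_inner_smul_left, real_inner_smul_right,
    real_inner_comm, inner_apply_self_eq_zero_of_skew hJ, Real.norm_eq_abs, Real.norm_eq_abs,
    sq_abs, sq_abs]
  have hsin : Real.sin (t * r) / r * r = Real.sin (t * r) := div_mul_cancel₀ _ hr
  linear_combination ‖S‖ ^ 2 * Real.sin_sq_add_cos_sq (t * r) +
    ‖S‖ ^ 2 * (Real.sin (t * r) / r * r + Real.sin (t * r)) * hsin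

/-- The spinor product of a spinor with itself vanishes. -/
theorem spinor_product_self {z v : Type*}
    [NormedAddCommGroup z] [InnerProductSpace ℝ z]
    [NormedAddCommGroup v] [InnerProductSpace ℝ v]
    {c : z →ₗ[ℝ] v →ₗ[ℝ] v}
    (hc : ∀ (Z : z) (S S' : v), ⟪c Z S, S'⟫ = -⟪S, c Z S'⟫)
    {sp : v →ₗ[ℝ] v →ₗ[ℝ] z}
    (hsp : ∀ (Z : z) (S S' : v), ⟪Z, sp S S'⟫ = ⟪c Z S, S'⟫) (S : v) :
    sp S S = 0 := by
  rw [← inner_self_eq_zero (𝕜 := ℝ), hsp, inner_apply_self_eq_zero_of_skew (hc _)]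

/-- The curve
`X(t) = (X_z, cos(t‖X_z‖) X_v + (sin(t‖X_z‖)/‖X_z‖) (X_z ∙ X_v))` satisfies
`X'(t) = (0, X_z ∙ X_v(t)) = −∇_{X(t)} X(t)`, i.e. the left-invariant geodesic equation of
the H-type group associated with `(z, v)`, and `‖X_v(t)‖ = ‖X_v‖` for all `t`. -/
theorem stmt_12 {z v : Type*}
    [NormedAddCommGroup z] [InnerProductSpace ℝ z] [FiniteDimensional ℝ z]
    [NormedAddCommGroup v] [InnerProductSpace ℝ v] [FiniteDimensional ℝ v]
    [Nontrivial v]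
    (c : z →ₗ[ℝ] v →ₗ[ℝ] v)
    (hc1 : ∀ (Z : z) (S S' : v), ⟪c Z S, S'⟫ = -⟪S, c Z S'⟫)
    (hc2 : ∀ (Z : z) (S : v), c Z (c Z S) = (-‖Z‖ ^ 2 : ℝ) • S)
    (sp : v →ₗ[ℝ] v →ₗ[ℝ] z)
    (hsp : ∀ (Z : z) (S S' : v), ⟪Z, sp S S'⟫ = ⟪c Z S, S'⟫)
    (Xz : z) (hXz : Xz ≠ 0) (Xv : v)
    (nabla : z × v → z × v → z × v)
    (hnabla : ∀ A B : z × v,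
      nabla A B = ((1/2 : ℝ) • sp A.2 B.2, -((1/2 : ℝ) • (c A.1 B.2 + c B.1 A.2))))
    (Xc : ℝ → z × v)
    (hXc : ∀ t : ℝ, Xc t =
      (Xz, Real.cos (t * ‖Xz‖) • Xv + (Real.sin (t * ‖Xz‖) / ‖Xz‖) • c Xz Xv)) :
    ∀ t : ℝ,
      HasDerivAt Xc ((0 : z), c Xz (Xc t).2) t ∧
      (((0 : z), c Xz (Xc t).2) : z × v) = -nabla (Xc t) (Xc t) ∧
      ‖(Xc t).2‖ = ‖Xv‖ := by
  have hr : ‖Xz‖ ≠ 0 := norm_ne_zero_iff.mpr hXz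
  obtain rfl : Xc = _ := funext hXc
  intro t
  refine ⟨(hasDerivAt_const t Xz).prodMk
    (hasDerivAt_cos_smul_add_sin_smul hr (hc2 Xz) Xv t), ?_,
    norm_cos_smul_add_sin_smul hr (hc1 Xz) (hc2 Xz) Xv t⟩
  rw [hnabla, spinor_product_self hc1 hsp, smul_zero, Prod.neg_mk, neg_zero, neg_neg,
    ← two_smul ℝ, smul_smul, one_div, inv_mul_cancel₀ two_ne_zero, one_smul]
end

section
/- Let ∙ be an orthogonal Clifford module structure on v over z, let X_z ∈ z with X_z ≠ 0 and X_v ∈ v, and set X_v(t) := cos(t·‖X_z‖)·X_v + (sin(t·‖X_z‖)/‖X_z‖)·(X_z ∙ X_v). Then for every t ∈ ℝ one has K̂((X_z, X_v(t))) = K̂((X_z, X_v)) as linear maps z → z; equivalently, ⟪Z₁ ∙ (X_z ∙ X_v(t)), Z₂ ∙ X_v(t)⟫ = ⟪Z₁ ∙ (X_z ∙ X_v), Z₂ ∙ X_v⟫ for all Z₁, Z₂ ∈ z and all t ∈ ℝ. (In particular, the eigenvalues of K̂(γ̇(t))² are constant along every geodesic γ of the associated H-type group.) -/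
open scoped RealInnerProductSpace

section CliffordModule

variable {z v : Type*} [NormedAddCommGroup z] [InnerProductSpace ℝ z]
  [NormedAddCommGroup v] [InnerProductSpace ℝ v]

theorem inner_clifford_clifford (c : z →ₗ[ℝ] v →ₗ[ℝ] v)
    (hc1 : ∀ (Z : z) (S S' : v), ⟪c Z S, S'⟫ = -⟪S, c Z S'⟫)
    (hc2 : ∀ (Z : z) (S : v), c Z (c Z S) = (-‖Z‖ ^ 2 : ℝ) • S) (Z : z) (x y : v) :
    ⟪c Z x, c Z y⟫ = ‖Z‖ ^ 2 * ⟪x, y⟫ := by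
  rw [hc1, hc2, inner_smul_right]
  ring

/-- Polarization of `inner_clifford_clifford` in the acting vector. -/
theorem inner_clifford_add_inner_clifford (c : z →ₗ[ℝ] v →ₗ[ℝ] v)
    (hc1 : ∀ (Z : z) (S S' : v), ⟪c Z S, S'⟫ = -⟪S, c Z S'⟫)
    (hc2 : ∀ (Z : z) (S : v), c Z (c Z S) = (-‖Z‖ ^ 2 : ℝ) • S) (Z W : z) (x y : v) :
    ⟪c Z x, c W y⟫ + ⟪c Z y, c W x⟫ = 2 * ⟪Z, W⟫ * ⟪x, y⟫ := by
  have h := inner_clifford_clifford c hc1 hc2 (Z + W) x y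
  simp only [map_add, LinearMap.add_apply, inner_add_left, inner_add_right,
    inner_clifford_clifford c hc1 hc2, norm_add_sq_real] at h
  linarith [real_inner_comm (c Z y) (c W x)]

end CliffordModule

/-- Along the geodesic velocity field
`X_v(t) = cos(t‖X_z‖) X_v + (sin(t‖X_z‖)/‖X_z‖) (X_z ∙ X_v)`, the operator
`K̂((X_z, X_v(t)))` is constant in `t`; equivalently, the defining bilinear form is
constant in `t`. -/
theorem stmt_13 {z v : Type*}
    [NormedAddCommGroup z] [InnerProductSpace ℝ z] [FiniteDimensional ℝ z]
    [NormedAddCommGroup v] [InnerProductSpace ℝ v] [FiniteDimensional ℝ v]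
    [Nontrivial v]
    (c : z →ₗ[ℝ] v →ₗ[ℝ] v)
    (hc1 : ∀ (Z : z) (S S' : v), ⟪c Z S, S'⟫ = -⟪S, c Z S'⟫)
    (hc2 : ∀ (Z : z) (S : v), c Z (c Z S) = (-‖Z‖ ^ 2 : ℝ) • S)
    (K : z × v → z →ₗ[ℝ] z)
    (hK : ∀ (X : z × v) (Z₁ Z₂ : z), ⟪K X Z₁, Z₂⟫ = ⟪c Z₁ (c X.1 X.2), c Z₂ X.2⟫)
    (Xz : z) (hXz : Xz ≠ 0) (Xv : v)
    (Xvt : ℝ → v)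
    (hXvt : ∀ t : ℝ, Xvt t =
      Real.cos (t * ‖Xz‖) • Xv + (Real.sin (t * ‖Xz‖) / ‖Xz‖) • c Xz Xv) :
    (∀ t : ℝ, K (Xz, Xvt t) = K (Xz, Xv)) ∧
    (∀ (t : ℝ) (Z₁ Z₂ : z),
      ⟪c Z₁ (c Xz (Xvt t)), c Z₂ (Xvt t)⟫ = ⟪c Z₁ (c Xz Xv), c Z₂ Xv⟫) := by
  have key : ∀ (t : ℝ) (Z₁ Z₂ : z),
      ⟪c Z₁ (c Xz (Xvt t)), c Z₂ (Xvt t)⟫ = ⟪c Z₁ (c Xz Xv), c Z₂ Xv⟫ := by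
    intro t Z₁ Z₂
    have hr : ‖Xz‖ ≠ 0 := norm_ne_zero_iff.mpr hXz
    have horth : ⟪Xv, c Xz Xv⟫ = 0 := by
      linarith [hc1 Xz Xv Xv, real_inner_comm Xv (c Xz Xv)]
    have hskew := inner_clifford_add_inner_clifford c hc1 hc2 Z₁ Z₂ Xv (c Xz Xv)
    have hx := inner_clifford_add_inner_clifford c hc1 hc2 Z₁ Z₂ Xv Xv
    have hJx := inner_clifford_add_inner_clifford c hc1 hc2 Z₁ Z₂ (c Xz Xv) (c Xz Xv)
    rw [inner_clifford_clifford c hc1 hc2] at hJx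
    rw [horth, mul_zero] at hskew
    have hscale : ⟪c Z₁ (c Xz Xv), c Z₂ (c Xz Xv)⟫ = ‖Xz‖ ^ 2 * ⟪c Z₁ Xv, c Z₂ Xv⟫ := by
      linear_combination hJx / 2 - ‖Xz‖ ^ 2 * hx / 2
    have hskew' : ⟪c Z₁ Xv, c Z₂ (c Xz Xv)⟫ = -⟪c Z₁ (c Xz Xv), c Z₂ Xv⟫ := by
      linarith
    simp only [hXvt, map_add, map_smul, hc2, inner_add_left, inner_add_right,
      real_inner_smul_left, real_inner_smul_right, hscale, hskew']
    field_simp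
    linear_combination ⟪c Z₁ (c Xz Xv), c Z₂ Xv⟫ * Real.sin_sq_add_cos_sq (t * ‖Xz‖)
  refine ⟨fun t => LinearMap.ext fun Z₁ => ext_inner_right ℝ fun Z₂ => ?_, key⟩
  rw [hK, hK]
  exact key t Z₁ Z₂
end

section
/- Let ∙ be an orthogonal Clifford module structure on v over z, and let X = (X_z, X_v) ∈ z × v with X_z ≠ 0 and X_v ≠ 0. Define the following ℝ-subspaces of z × v: 𝔫₃ := span{(X_z, 0), (0, X_v), (0, X_z ∙ X_v)}; ℍ := {(Z, 0) : Z ∈ z, ⟪Z, X_z⟫ = 0} + {(0, Z ∙ X_v) : Z ∈ z, ⟪Z, X_z⟫ = 0} + {(0, Z ∙ (X_z ∙ X_v)) : Z ∈ z, ⟪Z, X_z⟫ = 0}; and W := {(0, S) : S ∈ v and for all Z ∈ z, ⟪Z ∙ X_v, S⟫ = 0 and ⟪Z ∙ (X_z ∙ X_v), S⟫ = 0}. Then 𝔫₃, ℍ, W are pairwise orthogonal and 𝔫₃ + ℍ + W = z × v; i.e., z × v is the orthogonal direct sum of 𝔫₃, ℍ and W. -/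
open scoped RealInnerProductSpace

/-- For a skew Clifford action, orthogonal elements of `z` move a vector in orthogonal
directions. -/
theorem inner_clifford_eq_zero_of_inner_eq_zero {z v : Type*}
    [NormedAddCommGroup z] [InnerProductSpace ℝ z]
    [NormedAddCommGroup v] [InnerProductSpace ℝ v]
    (c : z →ₗ[ℝ] v →ₗ[ℝ] v)
    (hc1 : ∀ (Z : z) (S S' : v), ⟪c Z S, S'⟫ = -⟪S, c Z S'⟫)
    (hc2 : ∀ (Z : z) (S : v), c Z (c Z S) = (-‖Z‖ ^ 2 : ℝ) • S)
    {Z Z' : z} (h : ⟪Z, Z'⟫ = 0) (S : v) : ⟪c Z S, c Z' S⟫ = 0 := by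
  have norm_sq (Y : z) : ⟪c Y S, c Y S⟫ = ‖Y‖ ^ 2 * ⟪S, S⟫ := by
    rw [hc1, hc2, inner_smul_right]
    ring
  have hadd := norm_sq (Z + Z')
  simp only [map_add, LinearMap.add_apply, inner_add_left, inner_add_right, norm_sq,
    norm_add_sq_real, h, real_inner_comm (c Z S) (c Z' S)] at hadd
  linarith [real_inner_comm (c Z S) (c Z' S)]

/-- For `X = (X_z, X_v)` with `X_z ≠ 0 ≠ X_v`, the space `z × v` (with the
product inner product `ip`) is the orthogonal direct sum of `𝔫₃`, `ℍ` and `W`. -/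
theorem stmt_14 {z v : Type*}
    [NormedAddCommGroup z] [InnerProductSpace ℝ z] [FiniteDimensional ℝ z]
    [NormedAddCommGroup v] [InnerProductSpace ℝ v] [FiniteDimensional ℝ v]
    [Nontrivial v]
    (c : z →ₗ[ℝ] v →ₗ[ℝ] v)
    (hc1 : ∀ (Z : z) (S S' : v), ⟪c Z S, S'⟫ = -⟪S, c Z S'⟫)
    (hc2 : ∀ (Z : z) (S : v), c Z (c Z S) = (-‖Z‖ ^ 2 : ℝ) • S)
    (X : z × v) (hXz : X.1 ≠ 0) (hXv : X.2 ≠ 0)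
    (ip : z × v → z × v → ℝ)
    (hip : ∀ p q : z × v, ip p q = ⟪p.1, q.1⟫ + ⟪p.2, q.2⟫)
    (N3 : Submodule ℝ (z × v))
    (hN3 : N3 = Submodule.span ℝ {(X.1, (0 : v)), ((0 : z), X.2), ((0 : z), c X.1 X.2)})
    (H : Submodule ℝ (z × v))
    (hH : H =
      Submodule.map (LinearMap.inl ℝ z v) (Submodule.span ℝ {X.1})ᗮ ⊔
      Submodule.map ((LinearMap.inr ℝ z v).comp (c.flip X.2)) (Submodule.span ℝ {X.1})ᗮ ⊔
      Submodule.map ((LinearMap.inr ℝ z v).comp (c.flip (c X.1 X.2)))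
        (Submodule.span ℝ {X.1})ᗮ)
    (W : Set (z × v))
    (hW : W = {p : z × v | p.1 = 0 ∧ ∀ Z : z,
      ⟪c Z X.2, p.2⟫ = 0 ∧ ⟪c Z (c X.1 X.2), p.2⟫ = 0}) :
    (∀ x ∈ N3, ∀ y ∈ H, ip x y = 0) ∧
    (∀ x ∈ N3, ∀ w ∈ W, ip x w = 0) ∧
    (∀ y ∈ H, ∀ w ∈ W, ip y w = 0) ∧
    (∀ u : z × v, ∃ x ∈ N3, ∃ y ∈ H, ∃ w ∈ W, u = x + y + w) := by
  have skew (Z : z) (S : v) : ⟪S, c Z S⟫ = 0 := by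
    linarith [hc1 Z S S, real_inner_comm S (c Z S)]
  have orth {Z : z} (hZ : Z ∈ (Submodule.span ℝ {X.1})ᗮ) : ⟪X.1, Z⟫ = 0 :=
    Submodule.mem_orthogonal_singleton_iff_inner_right.mp hZ
  have orth_act {Z : z} (hZ : Z ∈ (Submodule.span ℝ {X.1})ᗮ) :
      ⟪c X.1 X.2, c Z X.2⟫ = 0 :=
    inner_clifford_eq_zero_of_inner_eq_zero c hc1 hc2 (orth hZ) X.2
  have span_orth (y : z × v) (h1 : ip (X.1, 0) y = 0) (h2 : ip (0, X.2) y = 0)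
      (h3 : ip (0, c X.1 X.2) y = 0) : ∀ x ∈ N3, ip x y = 0 := by
    intro x hx
    rw [hN3] at hx
    induction hx using Submodule.span_induction with
    | mem x hx => rcases hx with rfl | rfl | rfl <;> assumption
    | zero => simp [hip]
    | add a b _ _ ha hb =>
      simp only [hip, Prod.fst_add, Prod.snd_add, inner_add_left] at ha hb ⊢
      linarith
    | smul r a _ ha =>
      simp only [hip, Prod.smul_fst, Prod.smul_snd, inner_smul_left] at ha ⊢
      rw [← mul_add, ha, mul_zero]
  have mem_H (y : z × v) : y ∈ H ↔ ∃ A ∈ (Submodule.span ℝ {X.1})ᗮ,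
      ∃ B ∈ (Submodule.span ℝ {X.1})ᗮ, ∃ C ∈ (Submodule.span ℝ {X.1})ᗮ,
      y = (A, c B X.2 + c C (c X.1 X.2)) := by
    rw [hH]
    simp only [Submodule.mem_sup, Submodule.mem_map]
    constructor
    · rintro ⟨_, ⟨_, ⟨A, hA, rfl⟩, _, ⟨B, hB, rfl⟩, rfl⟩, _, ⟨C, hC, rfl⟩, rfl⟩
      exact ⟨A, hA, B, hB, C, hC, by simp⟩
    · rintro ⟨A, hA, B, hB, C, hC, rfl⟩
      exact ⟨_, ⟨_, ⟨A, hA, rfl⟩, _, ⟨B, hB, rfl⟩, rfl⟩, _, ⟨C, hC, rfl⟩, by simp⟩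
  refine ⟨?_, ?_, ?_, ?_⟩
  · intro x hx y hy
    obtain ⟨A, hA, B, hB, C, hC, rfl⟩ := (mem_H y).mp hy
    refine span_orth _ ?_ ?_ ?_ x hx
    · simp [hip, orth hA]
    · have hswap := hc1 C X.2 (c X.1 X.2)
      rw [real_inner_comm, orth_act hC] at hswap
      simp only [hip, inner_zero_left, inner_add_right, skew]
      linarith
    · simp [hip, inner_add_right, orth_act hB, skew]
  · intro x hx w hw
    rw [hW] at hw
    obtain ⟨hw1, hw2⟩ := hw
    refine span_orth w ?_ ?_ ?_ x hx
    · simp [hip, hw1]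
    · have h := (hw2 X.1).2
      rw [hc2, real_inner_smul_left] at h
      have hne : -‖X.1‖ ^ 2 ≠ 0 := neg_ne_zero.mpr (pow_ne_zero 2 (norm_ne_zero_iff.mpr hXz))
      simp [hip, (mul_eq_zero.mp h).resolve_left hne]
    · simp [hip, (hw2 X.1).1]
  · intro y hy w hw
    rw [hW] at hw
    obtain ⟨hw1, hw2⟩ := hw
    obtain ⟨A, _, B, _, C, _, rfl⟩ := (mem_H y).mp hy
    simp [hip, hw1, inner_add_left, (hw2 B).1, (hw2 C).2]
  · rintro ⟨a, s⟩
    have split (Z : z) : ∃ t : ℝ, ∃ Z' ∈ (Submodule.span ℝ {X.1})ᗮ, Z = t • X.1 + Z' := by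
      obtain ⟨p, hp, q, hq, rfl⟩ := (Submodule.span ℝ {X.1}).exists_add_mem_mem_orthogonal Z
      obtain ⟨t, rfl⟩ := Submodule.mem_span_singleton.mp hp
      exact ⟨t, q, hq, rfl⟩
    obtain ⟨k, hk, w, hw, rfl⟩ := Submodule.exists_add_mem_mem_orthogonal
      (K := LinearMap.range (c.flip X.2) ⊔ LinearMap.range (c.flip (c X.1 X.2))) s
    obtain ⟨_, ⟨Z₁, rfl⟩, _, ⟨Z₂, rfl⟩, rfl⟩ := Submodule.mem_sup.mp hk
    obtain ⟨t, A, hA, rfl⟩ := split a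
    obtain ⟨t₁, B, hB, rfl⟩ := split Z₁
    obtain ⟨t₂, C, hC, rfl⟩ := split Z₂
    refine ⟨t • (X.1, 0) + (t₂ * -‖X.1‖ ^ 2) • (0, X.2) + t₁ • (0, c X.1 X.2), ?_,
      (A, c B X.2 + c C (c X.1 X.2)), (mem_H _).mpr ⟨A, hA, B, hB, C, hC, rfl⟩,
      (0, w), ?_, ?_⟩
    · rw [hN3]
      refine add_mem (add_mem ?_ ?_) ?_ <;>
        exact Submodule.smul_mem _ _ (Submodule.subset_span (by simp))
    · rw [hW]
      exact ⟨rfl, fun Z =>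
        ⟨hw _ (Submodule.mem_sup_left ⟨Z, rfl⟩), hw _ (Submodule.mem_sup_right ⟨Z, rfl⟩)⟩⟩
    · ext
      · simp
      · simp only [LinearMap.flip_apply, map_add, map_smul,
          hc2, Prod.snd_add, Prod.smul_snd, smul_zero]
        module
end

section
/- Let ∙ be an orthogonal Clifford module structure on v over z, and let E₁, E₂, E₃, E₄ ∈ z be an orthonormal system (pairwise orthogonal unit vectors). Then the subspace {S ∈ v : E₁ ∙ (E₂ ∙ S) = E₃ ∙ (E₄ ∙ S)} of v has dimension exactly half the dimension of v; i.e., 2 · dim {S ∈ v : E₁ ∙ (E₂ ∙ S) = E₃ ∙ (E₄ ∙ S)} = dim v. -/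
open scoped RealInnerProductSpace

/-- Clifford multiplications by orthogonal vectors anticommute. -/
theorem clifford_anticomm_of_inner_eq_zero {z v : Type*}
    [NormedAddCommGroup z] [InnerProductSpace ℝ z] [AddCommGroup v] [Module ℝ v]
    (c : z →ₗ[ℝ] v →ₗ[ℝ] v)
    (hc : ∀ (Z : z) (S : v), c Z (c Z S) = (-‖Z‖ ^ 2 : ℝ) • S)
    {Z W : z} (h : ⟪Z, W⟫ = 0) (S : v) : c Z (c W S) = -c W (c Z S) := by
  have hs := hc (Z + W) S
  have hn : ‖Z + W‖ ^ 2 = ‖Z‖ ^ 2 + ‖W‖ ^ 2 := by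
    rw [norm_add_sq_real, h]
    ring
  simp only [map_add, LinearMap.add_apply, hc, hn, neg_add, add_smul] at hs
  rw [← sub_eq_zero] at hs
  rw [eq_neg_iff_add_eq_zero, ← hs]
  abel

/-- If `g` and `h` are commuting complex structures, and an injective `f` anticommutes with `g` and
commutes with `h`, then `g = h` on a half-dimensional subspace. -/
theorem two_mul_finrank_ker_sub {v : Type*} [AddCommGroup v] [Module ℝ v]
    [FiniteDimensional ℝ v] (f g h : v →ₗ[ℝ] v) (hf : Function.Injective f)
    (hg : ∀ x, g (g x) = -x) (hh : ∀ x, h (h x) = -x) (hgh : ∀ x, g (h x) = h (g x))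
    (hfg : ∀ x, g (f x) = -f (g x)) (hfh : ∀ x, h (f x) = f (h x)) :
    2 * Module.finrank ℝ (LinearMap.ker (g - h)) = Module.finrank ℝ v := by
  have hker : (LinearMap.ker (g - h)).map f ≤ LinearMap.range (g - h) := by
    rintro _ ⟨x, hx, rfl⟩
    have hx' : g x = h x := by simpa [sub_eq_zero] using hx
    refine ⟨(-(1 / 2) : ℝ) • g (f x), ?_⟩
    have key : (g - h) (g (f x)) = -f x - f x := by
      rw [LinearMap.sub_apply, hg, hfg, map_neg, hfh, hx', hh, map_neg, neg_neg]
    rw [map_smul, key]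
    module
  have hrange : (LinearMap.range (g - h)).map f ≤ LinearMap.ker (g - h) := by
    rintro _ ⟨_, ⟨y, rfl⟩, rfl⟩
    simp [hfg, hfh, hg, hh, hgh, add_comm]
  have h₁ := Submodule.finrank_mono hker
  have h₂ := Submodule.finrank_mono hrange
  rw [← (Submodule.equivMapOfInjective f hf _).finrank_eq] at h₁ h₂
  have h₃ := LinearMap.finrank_range_add_finrank_ker (g - h)
  omega

/-- For any orthonormal system `E₁, E₂, E₃, E₄` in `z`, the subspace
`{S ∈ v | E₁ ∙ (E₂ ∙ S) = E₃ ∙ (E₄ ∙ S)}` has dimension exactly `dim v / 2`. -/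
theorem stmt_15 {z v : Type*}
    [NormedAddCommGroup z] [InnerProductSpace ℝ z] [FiniteDimensional ℝ z]
    [NormedAddCommGroup v] [InnerProductSpace ℝ v] [FiniteDimensional ℝ v]
    [Nontrivial v]
    (c : z →ₗ[ℝ] v →ₗ[ℝ] v)
    (hc1 : ∀ (Z : z) (S S' : v), ⟪c Z S, S'⟫ = -⟪S, c Z S'⟫)
    (hc2 : ∀ (Z : z) (S : v), c Z (c Z S) = (-‖Z‖ ^ 2 : ℝ) • S)
    (E₁ E₂ E₃ E₄ : z) (hON : Orthonormal ℝ ![E₁, E₂, E₃, E₄]) :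
    2 * Module.finrank ℝ
        (LinearMap.ker ((c E₁).comp (c E₂) - (c E₃).comp (c E₄)))
      = Module.finrank ℝ v := by
  have hinner : ∀ {i j : Fin 4}, i ≠ j →
      ⟪![E₁, E₂, E₃, E₄] i, ![E₁, E₂, E₃, E₄] j⟫ = 0 := fun hij => hON.2 hij
  have n₁ : ‖E₁‖ = 1 := hON.1 0
  have n₂ : ‖E₂‖ = 1 := hON.1 1
  have n₃ : ‖E₃‖ = 1 := hON.1 2
  have n₄ : ‖E₄‖ = 1 := hON.1 3
  have s₁ : ∀ S, c E₁ (c E₁ S) = -S := fun S => by simp [hc2, n₁]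
  have s₂ : ∀ S, c E₂ (c E₂ S) = -S := fun S => by simp [hc2, n₂]
  have s₃ : ∀ S, c E₃ (c E₃ S) = -S := fun S => by simp [hc2, n₃]
  have s₄ : ∀ S, c E₄ (c E₄ S) = -S := fun S => by simp [hc2, n₄]
  have a₂₁ := clifford_anticomm_of_inner_eq_zero (Z := E₂) (W := E₁) c hc2
    (hinner (i := 1) (j := 0) (by decide))
  have a₃₁ := clifford_anticomm_of_inner_eq_zero (Z := E₃) (W := E₁) c hc2
    (hinner (i := 2) (j := 0) (by decide))
  have a₃₂ := clifford_anticomm_of_inner_eq_zero (Z := E₃) (W := E₂) c hc2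
    (hinner (i := 2) (j := 1) (by decide))
  have a₄₁ := clifford_anticomm_of_inner_eq_zero (Z := E₄) (W := E₁) c hc2
    (hinner (i := 3) (j := 0) (by decide))
  have a₄₂ := clifford_anticomm_of_inner_eq_zero (Z := E₄) (W := E₂) c hc2
    (hinner (i := 3) (j := 1) (by decide))
  have a₄₃ := clifford_anticomm_of_inner_eq_zero (Z := E₄) (W := E₃) c hc2
    (hinner (i := 3) (j := 2) (by decide))
  apply two_mul_finrank_ker_sub (c E₁)
  · intro x y hxy
    simpa [s₁] using congrArg (c E₁) hxy
  all_goals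
    intro x
    simp only [LinearMap.comp_apply, a₂₁, a₃₁, a₃₂, a₄₁, a₄₂, a₄₃, s₁, s₂, s₃, s₄, map_neg, neg_neg]
end

section
/- Let ∙ be an orthogonal Clifford module structure on v over z, and assume dim z ≥ 8. Then 1 is not a global eigenvalue of the rescaled operator family −Ǩ²: there exist X_z ∈ z with X_z ≠ 0 and X_v ∈ v with X_v ≠ 0 such that the only Z ∈ z satisfying K̂((X_z, X_v))² Z = −‖X_z‖² · ‖X_v‖⁴ · Z is Z = 0. -/
open scoped RealInnerProductSpace

/-- The pairwise commutation sign in an anticommuting family. -/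
def anticommSign {ι : Type*} [DecidableEq ι] (i j : ι) : ℤ := if i = j then 1 else -1

theorem mul_mul_of_mul_eq_zsmul {R : Type*} [Ring R] {x y k : R} {s t : ℤ}
    (hx : x * k = s • (k * x)) (hy : y * k = t • (k * y)) :
    x * y * k = (s * t) • (k * (x * y)) := by
  rw [mul_assoc, hy, mul_smul_comm, ← mul_assoc, hx, smul_mul_assoc, smul_smul, mul_assoc,
    mul_comm t s]

theorem mul_mul_of_mul_eq_zsmul_right {R : Type*} [Ring R] {x k l : R} {s t : ℤ}
    (hk : x * k = s • (k * x)) (hl : x * l = t • (l * x)) :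
    x * (k * l) = (s * t) • (k * l * x) := by
  rw [← mul_assoc, hk, smul_mul_assoc, mul_assoc, hl, mul_smul_comm, smul_smul, mul_assoc]

theorem sq_mul_of_anticomm {R : Type*} [Ring R] {x y : R} (hx : x * x = -1) (hy : y * y = -1)
    (hxy : x * y = -(y * x)) : x * y * (x * y) = -1 := by
  calc x * y * (x * y) = x * (y * x) * y := by noncomm_ring
    _ = x * -(x * y) * y := by rw [hxy, neg_neg]
    _ = -(x * x * (y * y)) := by noncomm_ring
    _ = -1 := by rw [hx, hy]; noncomm_ring

/-- The product of the four members of a family `E` selected by `J`. -/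
def quadProd {ι R : Type*} [Ring R] (E : ι → R) (J : Fin 4 → ι) : R :=
  E (J 0) * E (J 1) * (E (J 2) * E (J 3))

/-- The commutation sign of a fourfold product with a member of the family. -/
def quadSign {ι : Type*} [DecidableEq ι] (J : Fin 4 → ι) (k : ι) : ℤ :=
  anticommSign (J 0) k * anticommSign (J 1) k * (anticommSign (J 2) k * anticommSign (J 3) k)

theorem quadProd_mul_self {ι R : Type*} [Ring R] {E : ι → R}
    (hE : ∀ i j, i ≠ j → E i * E j = -(E j * E i))
    (hE' : ∀ i, E i * E i = -1) {J : Fin 4 → ι} (hJ : Function.Injective J) :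
    quadProd E J * quadProd E J = 1 := by
  have hne : ∀ a b, a ≠ b → E (J a) * E (J b) = -(E (J b) * E (J a)) :=
    fun a b hab => hE _ _ (hJ.ne hab)
  have h1 := sq_mul_of_anticomm (hE' (J 0)) (hE' (J 1)) (hne 0 1 (by decide))
  have h2 := sq_mul_of_anticomm (hE' (J 2)) (hE' (J 3)) (hne 2 3 (by decide))
  have hs : ∀ a b, a ≠ b → E (J a) * E (J b) = (-1 : ℤ) • (E (J b) * E (J a)) := by
    intro a b hab
    simpa using hne a b hab
  have h3 := mul_mul_of_mul_eq_zsmul_right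
    (mul_mul_of_mul_eq_zsmul (hs 0 2 (by decide)) (hs 1 2 (by decide)))
    (mul_mul_of_mul_eq_zsmul (hs 0 3 (by decide)) (hs 1 3 (by decide)))
  norm_num at h3
  unfold quadProd
  calc _ = E (J 0) * E (J 1) * (E (J 2) * E (J 3) * (E (J 0) * E (J 1))) * (E (J 2) * E (J 3)) := by
        noncomm_ring
    _ = E (J 0) * E (J 1) * (E (J 0) * E (J 1)) * (E (J 2) * E (J 3) * (E (J 2) * E (J 3))) := by
        rw [← h3]; noncomm_ring
    _ = 1 := by rw [h1, h2]; noncomm_ring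

section AnticommutingFamily

variable {ι R : Type*} [DecidableEq ι] [Ring R] {E : ι → R}

theorem mul_eq_anticommSign_zsmul (hE : ∀ i j, i ≠ j → E i * E j = -(E j * E i)) (i j : ι) :
    E i * E j = anticommSign i j • (E j * E i) := by
  unfold anticommSign
  split_ifs with h
  · simp [h]
  · simp [hE i j h]

theorem quadProd_mul (hE : ∀ i j, i ≠ j → E i * E j = -(E j * E i)) (J : Fin 4 → ι) (k : ι) :
    quadProd E J * E k = quadSign J k • (E k * quadProd E J) := by
  have h := fun i => mul_eq_anticommSign_zsmul hE i k
  exact mul_mul_of_mul_eq_zsmul (mul_mul_of_mul_eq_zsmul (h _) (h _))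
    (mul_mul_of_mul_eq_zsmul (h _) (h _))

theorem quadProd_mul_quadProd (hE : ∀ i j, i ≠ j → E i * E j = -(E j * E i))
    (J L : Fin 4 → ι) :
    quadProd E J * quadProd E L =
      (quadSign J (L 0) * quadSign J (L 1) * (quadSign J (L 2) * quadSign J (L 3))) •
        (quadProd E L * quadProd E J) := by
  have h := quadProd_mul hE J
  exact mul_mul_of_mul_eq_zsmul_right (mul_mul_of_mul_eq_zsmul_right (h _) (h _))
    (mul_mul_of_mul_eq_zsmul_right (h _) (h _))

end AnticommutingFamily

/-- Supports of a basis of the extended binary Hamming code of length eight. -/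
def hammingWord : Fin 4 → Fin 4 → Fin 8 :=
  ![![0, 1, 2, 3], ![4, 5, 6, 7], ![0, 1, 4, 5], ![0, 2, 4, 6]]

theorem hammingWord_injective (t : Fin 4) : Function.Injective (hammingWord t) := by
  revert t
  decide

theorem quadSign_comp {ι κ : Type*} [DecidableEq ι] [DecidableEq κ] {f : κ → ι}
    (hf : Function.Injective f) (J : Fin 4 → κ) (k : κ) :
    quadSign (f ∘ J) (f k) = quadSign J k := by
  simp [quadSign, anticommSign, hf.eq_iff]

theorem quadSign_comp_of_notMem_range {ι κ : Type*} [DecidableEq ι] {f : κ → ι}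
    (J : Fin 4 → κ) {k : ι} (hk : k ∉ Set.range f) : quadSign (f ∘ J) k = 1 := by
  have h : ∀ p, f p ≠ k := fun p hp => hk ⟨p, hp⟩
  simp [quadSign, anticommSign, h]

theorem exists_quadSign_hammingWord_eq_neg_one {ι : Type*} [DecidableEq ι] {f : Fin 8 → ι}
    (hf : Function.Injective f) {i j : ι} (hi : i ≠ f 0) (hj : j ≠ f 0) :
    ∃ t, quadSign (f ∘ hammingWord t) (f 0) * quadSign (f ∘ hammingWord t) i *
      quadSign (f ∘ hammingWord t) j = -1 := by
  have key : ∀ p q : Fin 8, ∃ t, quadSign (hammingWord t) 0 * quadSign (hammingWord t) p *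
      quadSign (hammingWord t) q = -1 := by decide
  have key' : ∀ p : Fin 8, p ≠ 0 →
      ∃ t, quadSign (hammingWord t) 0 * quadSign (hammingWord t) p = -1 := by decide
  by_cases hi' : i ∈ Set.range f <;> by_cases hj' : j ∈ Set.range f
  · obtain ⟨p, rfl⟩ := hi'
    obtain ⟨q, rfl⟩ := hj'
    simpa only [quadSign_comp hf] using key p q
  · obtain ⟨p, rfl⟩ := hi'
    simpa only [quadSign_comp hf, quadSign_comp_of_notMem_range _ hj', mul_one] using
      key' p (by rintro rfl; exact hi rfl)
  · obtain ⟨q, rfl⟩ := hj'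
    simpa only [quadSign_comp hf, quadSign_comp_of_notMem_range _ hi', mul_one] using
      key' q (by rintro rfl; exact hj rfl)
  · refine ⟨0, ?_⟩
    rw [quadSign_comp_of_notMem_range _ hi', quadSign_comp_of_notMem_range _ hj',
      quadSign_comp hf]
    decide

theorem commute_quadProd_hammingWord {ι R : Type*} [DecidableEq ι] [Ring R] {E : ι → R}
    (hE : ∀ i j, i ≠ j → E i * E j = -(E j * E i)) {f : Fin 8 → ι}
    (hf : Function.Injective f) (t u : Fin 4) :
    Commute (quadProd E (f ∘ hammingWord t)) (quadProd E (f ∘ hammingWord u)) := by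
  have key : ∀ t u : Fin 4, quadSign (hammingWord t) (hammingWord u 0) *
      quadSign (hammingWord t) (hammingWord u 1) * (quadSign (hammingWord t) (hammingWord u 2) *
        quadSign (hammingWord t) (hammingWord u 3)) = 1 := by decide
  have h := quadProd_mul_quadProd hE (f ∘ hammingWord t) (f ∘ hammingWord u)
  simp only [Function.comp_apply, quadSign_comp hf, key, one_smul] at h
  exact h

section Module

variable {V : Type*} [AddCommGroup V] [Module ℝ V]

theorem exists_eigenvector_of_involution {g : Module.End ℝ V} (hg : g * g = 1) {x : V}
    (hx : x ≠ 0) :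
    ∃ y ≠ 0, (∃ ε : ℝ, g y = ε • y) ∧
      ∀ h : Module.End ℝ V, Commute h g → ∀ ε : ℝ, h x = ε • x → h y = ε • y := by
  have hgg : g (g x) = x := by
    simpa using congrArg (fun T : Module.End ℝ V => T x) hg
  by_cases h0 : x + g x = 0
  · exact ⟨x, hx, ⟨-1, by simpa using eq_neg_of_add_eq_zero_right h0⟩, fun _ _ _ h => h⟩
  · refine ⟨x + g x, h0, ⟨1, by rw [map_add, hgg, one_smul, add_comm]⟩, fun h hc ε he => ?_⟩
    have : h (g x) = g (h x) := by
      simpa using congrArg (fun T : Module.End ℝ V => T x) hc.eq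
    rw [map_add, this, he, map_smul, smul_add]

theorem exists_common_eigenvector_of_involutions [Nontrivial V] {n : ℕ}
    (g : Fin n → Module.End ℝ V) (hg : ∀ t, g t * g t = 1) (hc : ∀ t u, Commute (g t) (g u)) :
    ∃ x ≠ 0, ∀ t, ∃ ε : ℝ, g t x = ε • x := by
  induction n with
  | zero =>
    obtain ⟨x, hx⟩ := exists_ne (0 : V)
    exact ⟨x, hx, fun t => t.elim0⟩
  | succ n ih =>
    obtain ⟨x, hx, hε⟩ := ih (fun t => g t.succ) (fun t => hg _) (fun t u => hc _ _)
    obtain ⟨y, hy, hy0, hyε⟩ := exists_eigenvector_of_involution (hg 0) hx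
    refine ⟨y, hy, Fin.cases hy0 fun t => ?_⟩
    obtain ⟨ε, h⟩ := hε t
    exact ⟨ε, hyε _ (hc _ _) ε h⟩

end Module

section InnerProduct

variable {V ι : Type*} [NormedAddCommGroup V] [InnerProductSpace ℝ V]

theorem inner_quadProd_quadProd {E : ι → Module.End ℝ V}
    (h : ∀ i x y, ⟪E i x, E i y⟫ = ⟪x, y⟫) (J : Fin 4 → ι) (x y : V) :
    ⟪quadProd E J x, quadProd E J y⟫ = ⟪x, y⟫ := by
  simp [quadProd, h]

/-- If `S` is an eigenvector of an isometry `g` that commutes with `A`, `B`, `C` up to signs whose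
product is `-1`, then `⟪A (B S), C S⟫` vanishes. -/
theorem inner_eq_zero_of_sign {g A B C : Module.End ℝ V}
    (hg : ∀ x y, ⟪g x, g y⟫ = ⟪x, y⟫) {S : V} (hS : ∃ ε : ℝ, g S = ε • S) {a b c : ℤ}
    (hA : g * A = a • (A * g)) (hB : g * B = b • (B * g)) (hC : g * C = c • (C * g))
    (habc : b * a * c = -1) : ⟪A (B S), C S⟫ = 0 := by
  obtain ⟨ε, hε⟩ := hS
  by_cases hS0 : S = 0
  · simp [hS0]
  have hε2 : ε * ε = 1 := by
    have h := hg S S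
    rw [hε, real_inner_smul_left, real_inner_smul_right, ← mul_assoc] at h
    exact mul_right_cancel₀ (inner_self_ne_zero.mpr hS0) (by rw [h, one_mul])
  have app : ∀ {T : Module.End ℝ V} {s : ℤ}, g * T = s • (T * g) →
      ∀ x, g (T x) = (s : ℝ) • T (g x) := by
    intro T s h x
    simpa [Int.cast_smul_eq_zsmul] using congrArg (fun U : Module.End ℝ V => U x) h
  have h := hg (A (B S)) (C S)
  simp only [app hA, app hB, app hC, hε, map_smul, real_inner_smul_left,
    real_inner_smul_right] at h
  have habc' : (b : ℝ) * a * c = -1 := by exact_mod_cast habc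
  have : ((b : ℝ) * a * c) * (ε * ε) * ⟪A (B S), C S⟫ = ⟪A (B S), C S⟫ := by
    linear_combination h
  rw [habc', hε2] at this
  linarith

end InnerProduct

/-- If `dim z ≥ 8`, then `1` is not a global eigenvalue of `−Ǩ²`: there is a
point `X = (X_z, X_v)` with `X_z ≠ 0 ≠ X_v` at which the eigenvalue equation
`K̂(X)² Z = −‖X_z‖²‖X_v‖⁴ Z` has only the trivial solution. -/
theorem stmt_16 {z v : Type*}
    [NormedAddCommGroup z] [InnerProductSpace ℝ z] [FiniteDimensional ℝ z]
    [NormedAddCommGroup v] [InnerProductSpace ℝ v] [FiniteDimensional ℝ v]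
    [Nontrivial v]
    (hdim : 8 ≤ Module.finrank ℝ z)
    (c : z →ₗ[ℝ] v →ₗ[ℝ] v)
    (hc1 : ∀ (Z : z) (S S' : v), ⟪c Z S, S'⟫ = -⟪S, c Z S'⟫)
    (hc2 : ∀ (Z : z) (S : v), c Z (c Z S) = (-‖Z‖ ^ 2 : ℝ) • S)
    (K : z × v → z →ₗ[ℝ] z)
    (hK : ∀ (X : z × v) (Z₁ Z₂ : z), ⟪K X Z₁, Z₂⟫ = ⟪c Z₁ (c X.1 X.2), c Z₂ X.2⟫) :
    ∃ Xz : z, Xz ≠ 0 ∧ ∃ Xv : v, Xv ≠ 0 ∧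
      ∀ Z : z, K (Xz, Xv) (K (Xz, Xv) Z) = (-(‖Xz‖ ^ 2 * ‖Xv‖ ^ 4) : ℝ) • Z → Z = 0 := by
  let b := stdOrthonormalBasis ℝ z
  let E : Fin (Module.finrank ℝ z) → Module.End ℝ v := fun i => c (b i)
  have hsq : ∀ i, E i * E i = -1 := by
    intro i
    ext S
    simp [E, hc2]
  have hanti : ∀ i j, i ≠ j → E i * E j = -(E j * E i) := by
    intro i j hij
    ext S
    have hn : ‖b i + b j‖ ^ 2 = 2 := by
      rw [norm_add_sq_real, b.inner_eq_zero hij]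
      norm_num
    have h := hc2 (b i + b j) S
    simp only [hn, map_add, LinearMap.add_apply, hc2, OrthonormalBasis.norm_eq_one] at h
    simp only [E, Module.End.mul_apply, LinearMap.neg_apply]
    rw [eq_neg_iff_add_eq_zero]
    linear_combination (norm := module) h
  have hskew : ∀ Z S, ⟪c Z S, S⟫ = 0 := by
    intro Z S
    have h := hc1 Z S S
    rw [real_inner_comm (c Z S) S] at h
    linarith
  have hiso : ∀ i x y, ⟪E i x, E i y⟫ = ⟪x, y⟫ := by
    intro i x y
    simp [E, hc1, hc2]
  let f : Fin 8 → Fin (Module.finrank ℝ z) := Fin.castLE hdim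
  have hf : Function.Injective f := Fin.castLE_injective hdim
  obtain ⟨S, hS, hε⟩ := exists_common_eigenvector_of_involutions
    (fun t => quadProd E (f ∘ hammingWord t))
    (fun t => quadProd_mul_self hanti hsq (hf.comp (hammingWord_injective t)))
    (commute_quadProd_hammingWord hanti hf)
  have hK0 : K (b (f 0), S) = 0 := by
    refine b.toBasis.ext fun i => InnerProductSpace.ext_inner_right_basis b.toBasis fun j => ?_
    simp only [OrthonormalBasis.coe_toBasis, hK, LinearMap.zero_apply, inner_zero_left]
    by_cases hi : i = f 0
    · rw [hi, hc2, real_inner_smul_left, real_inner_comm, hskew, mul_zero]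
    by_cases hj : j = f 0
    · rw [hj, hskew]
    obtain ⟨t, ht⟩ := exists_quadSign_hammingWord_eq_neg_one hf hi hj
    exact inner_eq_zero_of_sign (inner_quadProd_quadProd hiso (f ∘ hammingWord t)) (hε t)
      (quadProd_mul hanti _ i) (quadProd_mul hanti _ (f 0)) (quadProd_mul hanti _ j) ht
  have hb : b (f 0) ≠ 0 := b.orthonormal.ne_zero (f 0)
  refine ⟨b (f 0), hb, S, hS, fun Z hZ => ?_⟩
  rw [hK0, LinearMap.zero_apply] at hZ
  refine (smul_eq_zero.mp hZ.symm).resolve_left (neg_ne_zero.mpr ?_)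
  exact mul_ne_zero (pow_ne_zero _ (norm_ne_zero_iff.mpr hb))
    (pow_ne_zero _ (norm_ne_zero_iff.mpr hS))
end

section
/- For all real numbers μ, z, v define the 6×6 real matrices C := (1/2)·[[0, 0, v², 0, 0, −μ·v²·z], [0, 0, 0, v², v²·z, 0], [−1, 0, 0, 0, −3·z², 0], [0, −1, 0, 0, 0, −3·z²], [0, 0, 3, 0, 0, 0], [0, 0, 0, 3, 0, 0]] and B₀ := (1/4)·[[v², 0, 0, 3·μ·v²·z, 3·v²·z², 0], [0, v², −3·v²·z, 0, 0, 3·v²·z²], [0, 0, z² − 3·v², 0, 0, 3·μ·v²·z], [0, 0, 0, z² − 3·v², −3·v²·z, 0], [3, 0, 0, 0, z², 0], [0, 3, 0, 0, 0, z²]], and set recursively B_{i+1} := C·B_i − B_i·C. Then B₇ + (27/2·z² + 3/2·v²)·B₅ + (729/16·z⁴ + 81/8·z²·v² + 9/16·v⁴)·B₃ + (729/16·z⁶ + 243/16·z⁴·v² + (27/16 − 243/64·μ)·z²·v⁴ + 1/16·v⁶)·B₁ = 0 (the zero 6×6 matrix). -/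
/-- The real `6 × 6` form of the `3 × 3` matrix `!![a, b J, c; d J, e, f J; g, h J, k]` whose
entries are `2 × 2` blocks, where `J = !![0, μ; -1, 0]` satisfies `J ^ 2 = -μ`. -/
def evenBlock (μ a b c d e f g h k : ℝ) : Matrix (Fin 6) (Fin 6) ℝ :=
  !![a, 0, 0, μ * b, c, 0;
     0, a, -b, 0, 0, c;
     0, μ * d, e, 0, 0, μ * f;
     -d, 0, 0, e, -f, 0;
     g, 0, 0, μ * h, k, 0;
     0, g, -h, 0, 0, k]

/-- The real `6 × 6` form of the `3 × 3` matrix `!![a J, b, c J; d, e J, f; g J, h, k J]` whose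
entries are `2 × 2` blocks, where `J = !![0, μ; -1, 0]` satisfies `J ^ 2 = -μ`. -/
def oddBlock (μ a b c d e f g h k : ℝ) : Matrix (Fin 6) (Fin 6) ℝ :=
  !![0, μ * a, b, 0, 0, μ * c;
     -a, 0, 0, b, -c, 0;
     d, 0, 0, μ * e, f, 0;
     0, d, -e, 0, 0, f;
     0, μ * g, h, 0, 0, μ * k;
     -g, 0, 0, h, -k, 0]

/-- The `𝔠₀`-structure block. -/
noncomputable def structureBlock (μ z v : ℝ) : Matrix (Fin 6) (Fin 6) ℝ :=
  oddBlock μ 0 (v ^ 2 / 2) (-(v ^ 2 * z) / 2) (-1 / 2) 0 (-(3 * z ^ 2) / 2) 0 (3 / 2) 0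

set_option maxHeartbeats 2000000 in
/-- The commutator with the structure block maps even blocks to odd blocks. -/
lemma structureBlock_commutator_evenBlock (μ z v a b c d e f g h k : ℝ) :
    structureBlock μ z v * evenBlock μ a b c d e f g h k
        - evenBlock μ a b c d e f g h k * structureBlock μ z v =
      oddBlock μ
        ((v ^ 2 * d - v ^ 2 * z * g + b) / 2)
        ((v ^ 2 * e + μ * v ^ 2 * z * h - v ^ 2 * a - 3 * c) / 2)
        ((v ^ 2 * f - v ^ 2 * z * k + v ^ 2 * z * a + 3 * z ^ 2 * b) / 2)
        ((-a - 3 * z ^ 2 * g + e) / 2)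
        ((-b - 3 * z ^ 2 * h - v ^ 2 * d - 3 * f) / 2)
        ((-c - 3 * z ^ 2 * k - μ * v ^ 2 * z * d + 3 * z ^ 2 * e) / 2)
        ((3 * d + h) / 2)
        ((3 * e - v ^ 2 * g - 3 * k) / 2)
        ((3 * f + v ^ 2 * z * g + 3 * z ^ 2 * h) / 2) := by
  ext i j
  fin_cases i <;> fin_cases j <;>
    simp [structureBlock, evenBlock, oddBlock] <;> ring

set_option maxHeartbeats 2000000 in
/-- The commutator with the structure block maps odd blocks to even blocks. -/
lemma structureBlock_commutator_oddBlock (μ z v a b c d e f g h k : ℝ) :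
    structureBlock μ z v * oddBlock μ a b c d e f g h k
        - oddBlock μ a b c d e f g h k * structureBlock μ z v =
      evenBlock μ
        ((v ^ 2 * d + μ * v ^ 2 * z * g + b) / 2)
        ((v ^ 2 * e - v ^ 2 * z * h - v ^ 2 * a - 3 * c) / 2)
        ((v ^ 2 * f + μ * v ^ 2 * z * k - μ * v ^ 2 * z * a + 3 * z ^ 2 * b) / 2)
        ((-a - 3 * z ^ 2 * g + e) / 2)
        ((-b - 3 * z ^ 2 * h - v ^ 2 * d - 3 * f) / 2)
        ((-c - 3 * z ^ 2 * k + v ^ 2 * z * d + 3 * z ^ 2 * e) / 2)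
        ((3 * d + h) / 2)
        ((3 * e - v ^ 2 * g - 3 * k) / 2)
        ((3 * f - μ * v ^ 2 * z * g + 3 * z ^ 2 * h) / 2) := by
  ext i j
  fin_cases i <;> fin_cases j <;>
    simp [structureBlock, evenBlock, oddBlock] <;> ring

lemma oddBlock_add (μ a b c d e f g h k a' b' c' d' e' f' g' h' k' : ℝ) :
    oddBlock μ a b c d e f g h k + oddBlock μ a' b' c' d' e' f' g' h' k' =
      oddBlock μ (a + a') (b + b') (c + c') (d + d') (e + e') (f + f') (g + g') (h + h')
        (k + k') := by
  ext i j
  fin_cases i <;> fin_cases j <;> simp [oddBlock] <;> ring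

lemma smul_oddBlock (r μ a b c d e f g h k : ℝ) :
    r • oddBlock μ a b c d e f g h k =
      oddBlock μ (r * a) (r * b) (r * c) (r * d) (r * e) (r * f) (r * g) (r * h) (r * k) := by
  ext i j
  fin_cases i <;> fin_cases j <;> simp [oddBlock] <;> ring

lemma oddBlock_zero (μ : ℝ) : oddBlock μ 0 0 0 0 0 0 0 0 0 = 0 := by
  ext i j
  fin_cases i <;> fin_cases j <;> simp [oddBlock]


set_option maxHeartbeats 2000000 in
/-- The explicit annihilating-polynomial identity for the 6×6 curvature block
`B₀` under the iterated commutator with the `𝔠₀`-structure block `C`. -/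
theorem stmt_17 (μ z v : ℝ)
    (C B₀ : Matrix (Fin 6) (Fin 6) ℝ)
    (hC : C = (1/2 : ℝ) •
      !![0, 0, v^2, 0, 0, -(μ*v^2*z);
         0, 0, 0, v^2, v^2*z, 0;
         -1, 0, 0, 0, -(3*z^2), 0;
         0, -1, 0, 0, 0, -(3*z^2);
         0, 0, 3, 0, 0, 0;
         0, 0, 0, 3, 0, 0])
    (hB₀ : B₀ = (1/4 : ℝ) •
      !![v^2, 0, 0, 3*μ*v^2*z, 3*v^2*z^2, 0;
         0, v^2, -(3*v^2*z), 0, 0, 3*v^2*z^2;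
         0, 0, z^2 - 3*v^2, 0, 0, 3*μ*v^2*z;
         0, 0, 0, z^2 - 3*v^2, -(3*v^2*z), 0;
         3, 0, 0, 0, z^2, 0;
         0, 3, 0, 0, 0, z^2])
    (B : ℕ → Matrix (Fin 6) (Fin 6) ℝ)
    (hB0 : B 0 = B₀)
    (hBsucc : ∀ i : ℕ, B (i + 1) = C * B i - B i * C) :
    B 7 + (27/2*z^2 + 3/2*v^2) • B 5
      + (729/16*z^4 + 81/8*z^2*v^2 + 9/16*v^4) • B 3
      + (729/16*z^6 + 243/16*z^4*v^2 + (27/16 - 243/64*μ)*z^2*v^4 + 1/16*v^6) • B 1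
      = 0 := by
  have hC' : C = structureBlock μ z v := by
    rw [hC, structureBlock, oddBlock]
    ext i j
    fin_cases i <;> fin_cases j <;> simp <;> ring
  have h0 : B 0 = evenBlock μ (v ^ 2 / 4) (3 * v ^ 2 * z / 4) (3 * v ^ 2 * z ^ 2 / 4) 0
      ((z ^ 2 - 3 * v ^ 2) / 4) (3 * v ^ 2 * z / 4) (3 / 4) 0 (z ^ 2 / 4) := by
    rw [hB0, hB₀, evenBlock]
    ext i j
    fin_cases i <;> fin_cases j <;> simp <;> ring
  rw [hC'] at hBsucc
  have h1 : B 1 = oddBlock μ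
      0
      (-(v ^ 4 / 2) - z ^ 2 * v ^ 2)
      (z * v ^ 4 / 2 + z ^ 3 * v ^ 2)
      (-(v ^ 2 / 2) - z ^ 2)
      (-(3 * z * v ^ 2 / 2))
      (-(3 * z ^ 2 * v ^ 2 / 2))
      0
      (-(3 * v ^ 2 / 2))
      (3 * z * v ^ 2 / 2) := by
    rw [hBsucc 0, h0, structureBlock_commutator_evenBlock]
    congr 1 <;> ring
  have h2 : B 2 = evenBlock μ
      (-(v ^ 4 / 2) - z ^ 2 * v ^ 2)
      (-(3 * z * v ^ 4 / 4) - 3 * z ^ 3 * v ^ 2 / 2)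
      (3 * μ * z ^ 2 * v ^ 4 / 4 - 3 * z ^ 2 * v ^ 4 / 2 - 3 * z ^ 4 * v ^ 2 / 2)
      (-(3 * z * v ^ 2 / 4))
      (v ^ 4 / 2 + 11 * z ^ 2 * v ^ 2 / 2)
      (-(z * v ^ 4 / 2) - 11 * z ^ 3 * v ^ 2 / 2)
      (-(3 * v ^ 2 / 2) - 3 * z ^ 2 / 2)
      (-(9 * z * v ^ 2 / 2))
      (-(9 * z ^ 2 * v ^ 2 / 2)) := by
    rw [hBsucc 1, h1, structureBlock_commutator_oddBlock]
    congr 1 <;> ring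
  have h3 : B 3 = oddBlock μ
      0
      (v ^ 6 / 2 + 11 * z ^ 2 * v ^ 4 / 2 + 9 * z ^ 4 * v ^ 2 / 4 - 27 * μ * z ^ 2 * v ^ 4 / 8)
      (-(z * v ^ 6 / 2) - 17 * z ^ 3 * v ^ 4 / 8 - 9 * z ^ 5 * v ^ 2 / 4)
      (v ^ 4 / 2 + 11 * z ^ 2 * v ^ 2 / 2 + 9 * z ^ 4 / 4)
      (3 * z * v ^ 4 / 2 + 63 * z ^ 3 * v ^ 2 / 4)
      (3 * z ^ 2 * v ^ 4 / 2 + 63 * z ^ 4 * v ^ 2 / 4)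
      (-(27 * z * v ^ 2 / 8))
      (3 * v ^ 4 / 2 + 63 * z ^ 2 * v ^ 2 / 4)
      (-(3 * z * v ^ 4 / 2) - 63 * z ^ 3 * v ^ 2 / 4) := by
    rw [hBsucc 2, h2, structureBlock_commutator_evenBlock]
    congr 1 <;> ring
  have h4 : B 4 = evenBlock μ
      (v ^ 6 / 2 + 11 * z ^ 2 * v ^ 4 / 2 + 9 * z ^ 4 * v ^ 2 / 4 - 27 * μ * z ^ 2 * v ^ 4 / 8)
      (3 * z * v ^ 6 / 4 + 51 * z ^ 3 * v ^ 4 / 16 + 27 * z ^ 5 * v ^ 2 / 8)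
      (3 * z ^ 2 * v ^ 6 / 2 + 129 * z ^ 4 * v ^ 4 / 8 + 27 * z ^ 6 * v ^ 2 / 8
        - 3 * μ * z ^ 2 * v ^ 6 / 4 - 207 * μ * z ^ 4 * v ^ 4 / 16)
      (3 * z * v ^ 4 / 4 + 207 * z ^ 3 * v ^ 2 / 16)
      (27 * μ * z ^ 2 * v ^ 4 / 16 - v ^ 6 / 2 - 10 * z ^ 2 * v ^ 4 - 99 * z ^ 4 * v ^ 2 / 2)
      (z * v ^ 6 / 2 + 133 * z ^ 3 * v ^ 4 / 16 + 99 * z ^ 5 * v ^ 2 / 2)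
      (3 * v ^ 4 / 2 + 129 * z ^ 2 * v ^ 2 / 8 + 27 * z ^ 4 / 8)
      (99 * z * v ^ 4 / 16 + 189 * z ^ 3 * v ^ 2 / 4)
      (9 * z ^ 2 * v ^ 4 / 2 + 189 * z ^ 4 * v ^ 2 / 4 + 27 * μ * z ^ 2 * v ^ 4 / 16) := by
    rw [hBsucc 3, h3, structureBlock_commutator_oddBlock]
    congr 1 <;> ring
  have h5 : B 5 = oddBlock μ
      0
      (27 * μ * z ^ 2 * v ^ 6 / 4 + 1377 * μ * z ^ 4 * v ^ 4 / 32 - v ^ 8 / 2 - 10 * z ^ 2 * v ^ 6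
        - 801 * z ^ 4 * v ^ 4 / 16 - 81 * z ^ 6 * v ^ 2 / 16)
      (z * v ^ 8 / 2 + 185 * z ^ 3 * v ^ 6 / 32 + 225 * z ^ 5 * v ^ 4 / 32
        + 81 * z ^ 7 * v ^ 2 / 16 - 81 * μ * z ^ 3 * v ^ 6 / 32)
      (81 * μ * z ^ 2 * v ^ 4 / 32 - v ^ 6 / 2 - 10 * z ^ 2 * v ^ 4 - 801 * z ^ 4 * v ^ 2 / 16
        - 81 * z ^ 6 / 16)
      (-(3 * z * v ^ 6 / 2) - 477 * z ^ 3 * v ^ 4 / 16 - 2349 * z ^ 5 * v ^ 2 / 16)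
      (-(3 * z ^ 2 * v ^ 6 / 2) - 477 * z ^ 4 * v ^ 4 / 16 - 2349 * z ^ 6 * v ^ 2 / 16)
      (135 * z * v ^ 4 / 32 + 1377 * z ^ 3 * v ^ 2 / 32)
      (-(3 * v ^ 6 / 2) - 477 * z ^ 2 * v ^ 4 / 16 - 2349 * z ^ 4 * v ^ 2 / 16)
      (3 * z * v ^ 6 / 2 + 477 * z ^ 3 * v ^ 4 / 16 + 2349 * z ^ 5 * v ^ 2 / 16) := by
    rw [hBsucc 4, h4, structureBlock_commutator_evenBlock]
    congr 1 <;> ring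
  have h6 : B 6 = evenBlock μ
      (27 * μ * z ^ 2 * v ^ 6 / 4 + 1377 * μ * z ^ 4 * v ^ 4 / 32 - v ^ 8 / 2 - 10 * z ^ 2 * v ^ 6
        - 801 * z ^ 4 * v ^ 4 / 16 - 81 * z ^ 6 * v ^ 2 / 16)
      (243 * μ * z ^ 3 * v ^ 6 / 64 - 3 * z * v ^ 8 / 4 - 555 * z ^ 3 * v ^ 6 / 64
        - 675 * z ^ 5 * v ^ 4 / 64 - 243 * z ^ 7 * v ^ 2 / 32)
      (3 * μ * z ^ 2 * v ^ 8 / 4 + 801 * μ * z ^ 4 * v ^ 6 / 32 + 8829 * μ * z ^ 6 * v ^ 4 / 64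
        - 3 * z ^ 2 * v ^ 8 / 2 - 957 * z ^ 4 * v ^ 6 / 32 - 297 * z ^ 6 * v ^ 4 / 2
        - 243 * z ^ 8 * v ^ 2 / 32)
      (-(3 * z * v ^ 6 / 4) - 1359 * z ^ 3 * v ^ 4 / 64 - 8829 * z ^ 5 * v ^ 2 / 64)
      (v ^ 8 / 2 + 29 * z ^ 2 * v ^ 6 / 2 + 279 * z ^ 4 * v ^ 4 / 2 + 891 * z ^ 6 * v ^ 2 / 2
        - 297 * μ * z ^ 2 * v ^ 6 / 64 - 1377 * μ * z ^ 4 * v ^ 4 / 64)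
      (81 * μ * z ^ 3 * v ^ 6 / 32 - z * v ^ 8 / 2 - 793 * z ^ 3 * v ^ 6 / 64
        - 7551 * z ^ 5 * v ^ 4 / 64 - 891 * z ^ 7 * v ^ 2 / 2)
      (243 * μ * z ^ 2 * v ^ 4 / 64 - 3 * v ^ 6 / 2 - 957 * z ^ 2 * v ^ 4 / 32
        - 297 * z ^ 4 * v ^ 2 / 2 - 243 * z ^ 6 / 32)
      (-(423 * z * v ^ 6 / 64) - 7101 * z ^ 3 * v ^ 4 / 64 - 7047 * z ^ 5 * v ^ 2 / 16)
      (-(9 * z ^ 2 * v ^ 6 / 2) - 1431 * z ^ 4 * v ^ 4 / 16 - 7047 * z ^ 6 * v ^ 2 / 16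
        - 135 * μ * z ^ 2 * v ^ 6 / 64 - 1377 * μ * z ^ 4 * v ^ 4 / 64) := by
    rw [hBsucc 5, h5, structureBlock_commutator_oddBlock]
    congr 1 <;> ring
  rw [hBsucc 6, h6, structureBlock_commutator_evenBlock, h5, h3, h1]
  simp only [smul_oddBlock, oddBlock_add]
  rw [← oddBlock_zero μ]
  congr 1 <;> ring
end

section
/- Define a₂(z, v) := 27/2·z² + 3/2·v², a₄(z, v) := 729/16·z⁴ + 81/8·z²·v² + 9/16·v⁴, and a₆(μ, z, v) := 729/16·z⁶ + 243/16·z⁴·v² + (27/16 − 243/64·μ)·z²·v⁴ + 1/16·v⁶. If z ≥ 0, v ≥ 0, (z, v) ≠ (0, 0), and μ < 1, then a₂(z, v) > 0, a₄(z, v) > 0, and a₆(μ, z, v) > 0. -/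
/-- Positivity of the coefficients `a₂, a₄, a₆` of the factor
`λ⁷ + a₂ λ⁵ + a₄ λ³ + a₆ λ` of the minimal polynomial, for `z, v ≥ 0`, `(z, v) ≠ (0, 0)`
and `μ < 1`. -/
theorem stmt_19 (μ z v : ℝ) (hz : 0 ≤ z) (hv : 0 ≤ v) (hzv : (z, v) ≠ (0, 0)) (hμ : μ < 1) :
    0 < 27/2 * z^2 + 3/2 * v^2 ∧
    0 < 729/16 * z^4 + 81/8 * z^2 * v^2 + 9/16 * v^4 ∧
    0 < 729/16 * z^6 + 243/16 * z^4 * v^2 + (27/16 - 243/64 * μ) * z^2 * v^4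
        + 1/16 * v^6 := by
  have key : 729/16 * z^6 + 243/16 * z^4 * v^2 + (27/16 - 243/64 * μ) * z^2 * v^4
      + 1/16 * v^6 = (18 * z^2 - v^2)^2 * (9 * z^2 + 4 * v^2) / 64
        + 243/64 * (1 - μ) * (z^2 * v^4) := by ring
  rw [key]
  have hμ' : 0 < 1 - μ := sub_pos.mpr hμ
  rcases hz.eq_or_lt with rfl | hz
  · rcases hv.eq_or_lt with rfl | hv
    · exact absurd rfl hzv
    · refine ⟨by positivity, by positivity, ?_⟩
      have : 0 < v^6 := by positivity
      linarith
  · refine ⟨by positivity, by positivity, ?_⟩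
    rcases hv.eq_or_lt with rfl | hv
    · have : 0 < z^6 := by positivity
      linarith
    · positivity
end
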